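/- arXiv:cs/0510032 — 10 statements merged into one kernel-verified Lean document; each statement's English description precedes it below -/
import Mathlib

section
/- Let A be a real d×n matrix and y ∈ ℝ^d. Suppose x0 ∈ ℝ^n satisfies A x0 = y and has m nonzero entries with 2m < Spark(A). Then x0 is the unique sparsest representation of y: every x' ∈ ℝ^n with A x' = y and x' ≠ x0 has strictly more than m nonzero entries. -/
open Matrix

/-- `spark A` is the smallest number `σ` such that some set of `σ` columns of `A`
is linearly dependent (as an extended natural, `⊤` if no such set exists). -/
noncomputable def spark {d n : ℕ} (A : Matrix (Fin d) (Fin n) ℝ) : ℕ∞ :=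
  sInf {σ : ℕ∞ | ∃ s : Finset (Fin n), (s.card : ℕ∞) = σ ∧
    ¬ LinearIndependent ℝ (fun j : s => A.transpose j.val)}

/-- If `A x0 = y` and `x0` has `m` nonzero entries with `2 m < Spark(A)`, then every other
solution `x'` of `A x' = y` has strictly more than `m` nonzero entries. -/
theorem sparse_unique_of_spark {d n : ℕ} (A : Matrix (Fin d) (Fin n) ℝ) (y : Fin d → ℝ)
    (x0 : Fin n → ℝ) (m : ℕ)
    (hx0 : A.mulVec x0 = y)
    (hm : (Finset.univ.filter fun i => x0 i ≠ 0).card = m)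
    (hspark : ((2 * m : ℕ) : ℕ∞) < spark A) :
    ∀ x' : Fin n → ℝ, A.mulVec x' = y → x' ≠ x0 →
      m < (Finset.univ.filter fun i => x' i ≠ 0).card := by
  intro x' hx' hne
  by_contra hlt
  push Not at hlt
  set s0 := Finset.univ.filter fun i => x0 i ≠ 0 with hs0
  set s1 := Finset.univ.filter fun i => x' i ≠ 0 with hs1
  have hcard : (s0 ∪ s1).card ≤ 2 * m := by
    have := Finset.card_union_le s0 s1
    omega
  have hz : ∀ i, i ∉ s0 ∪ s1 → x' i - x0 i = 0 := by
    intro i hi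
    simp only [hs0, hs1, Finset.mem_union, Finset.mem_filter, Finset.mem_univ, true_and,
      not_or, not_not] at hi
    rw [hi.1, hi.2, sub_zero]
  have hdep : ¬ LinearIndependent ℝ (fun j : (s0 ∪ s1 : Finset (Fin n)) => A.transpose j.val) := by
    intro hli
    rw [Fintype.linearIndependent_iff] at hli
    have hsum : ∑ j : (s0 ∪ s1 : Finset (Fin n)), (x' j.val - x0 j.val) • A.transpose j.val = 0 := by
      rw [Finset.sum_coe_sort (s0 ∪ s1) (fun j => (x' j - x0 j) • A.transpose j)]
      rw [Finset.sum_subset (Finset.subset_univ _)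
        (fun i _ hi => by rw [hz i hi, zero_smul])]
      have h0 : A.mulVec (x' - x0) = 0 := by rw [Matrix.mulVec_sub, hx', hx0, sub_self]
      ext k
      have hk := congrFun h0 k
      simp only [Matrix.mulVec, dotProduct, Pi.sub_apply, Pi.zero_apply] at hk
      simp only [Finset.sum_apply, Pi.smul_apply, Matrix.transpose_apply, smul_eq_mul,
        Pi.zero_apply]
      rw [← hk]
      exact Finset.sum_congr rfl fun i _ => mul_comm _ _
    have hall := hli (fun j => x' j.val - x0 j.val) hsum
    apply hne
    ext i
    by_cases hi : i ∈ s0 ∪ s1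
    · exact sub_eq_zero.mp (hall ⟨i, hi⟩)
    · exact sub_eq_zero.mp (hz i hi)
  have hle : spark A ≤ ((s0 ∪ s1).card : ℕ∞) := sInf_le ⟨s0 ∪ s1, rfl, hdep⟩
  have h2 : ((s0 ∪ s1).card : ℕ∞) ≤ ((2 * m : ℕ) : ℕ∞) := by exact_mod_cast hcard
  exact absurd (hspark.trans_le (hle.trans h2)) (lt_irrefl _)
end

section
/- Let x0 ∈ ℝ^n satisfy A x0 = y, let S be the support of x0 with |S| = m, let x_opt ∈ ℝ^m be the vector of nonzero entries of x0 and A_opt the d×m submatrix of the corresponding columns of A, so y = A_opt x_opt. If A_opt has linearly independent columns and there exists c ∈ ℝ^d such that A_optᵀ c = sign(x_opt) and |a_jᵀ c| < 1 for every column a_j of A with index outside S, then x0 is the unique minimizer of ‖x‖₁ over {x ∈ ℝ^n : A x = y}. -/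
open Matrix

/-- **Fuchs Condition (sufficiency).** Let `A x0 = y`, let `S` be the support of `x0` with
`|S| = m`, and suppose the columns of `A` indexed by `S` (the matrix `A_opt`) are linearly
independent. If there exists `c ∈ ℝ^d` with `a_jᵀ c = sign(x0 j)` for every `j ∈ S` (i.e.
`A_optᵀ c = sign(x_opt)`) and `|a_jᵀ c| < 1` for every `j ∉ S`, then `x0` is the unique
minimizer of `‖x‖₁` over `{x : A x = y}`. -/
theorem fuchs_condition_sufficient {d n : ℕ} (A : Matrix (Fin d) (Fin n) ℝ) (y : Fin d → ℝ)
    (x0 : Fin n → ℝ) (S : Finset (Fin n)) (m : ℕ)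
    (hS : ∀ i, i ∈ S ↔ x0 i ≠ 0) (hcard : S.card = m)
    (hy : A.mulVec x0 = y)
    (hrank : LinearIndependent ℝ (fun j : S => A.transpose j.val))
    (hc : ∃ c : Fin d → ℝ,
      (∀ j ∈ S, A.transpose j ⬝ᵥ c = Real.sign (x0 j)) ∧
      (∀ j ∉ S, |A.transpose j ⬝ᵥ c| < 1)) :
    ∀ x : Fin n → ℝ, A.mulVec x = y → x ≠ x0 → ∑ i, |x0 i| < ∑ i, |x i| := by
  obtain ⟨c, hc1, hc2⟩ := hc
  intro x hx hne
  have key : ∀ z : Fin n → ℝ, A.mulVec z = y → ∑ j, (A.transpose j ⬝ᵥ c) * z j = c ⬝ᵥ y := by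
    intro z hz
    rw [← hz, Matrix.dotProduct_mulVec]
    refine Finset.sum_congr rfl fun j _ => ?_
    rw [dotProduct_comm]
    rfl
  have h0 : ∑ i, |x0 i| = ∑ j, (A.transpose j ⬝ᵥ c) * x0 j := by
    refine Finset.sum_congr rfl fun j _ => ?_
    by_cases hj : j ∈ S
    · rw [hc1 j hj]
      rcases lt_or_gt_of_ne ((hS j).1 hj) with h | h
      · rw [Real.sign_of_neg h, abs_of_neg h]; ring
      · rw [Real.sign_of_pos h, abs_of_pos h]; ring
    · have : x0 j = 0 := by
        by_contra h
        exact hj ((hS j).2 h)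
      simp [this]
  rw [h0, key x0 hy, ← key x hx]
  have hw : ∀ j, |A.transpose j ⬝ᵥ c| ≤ 1 := by
    intro j
    by_cases hj : j ∈ S
    · rw [hc1 j hj]
      rcases Real.sign_apply_eq (x0 j) with h | h | h <;> rw [h] <;> norm_num
    · exact (hc2 j hj).le
  have hex : ∃ j, j ∉ S ∧ x j ≠ 0 := by
    by_contra! hcon
    apply hne
    have hz : ∀ j, j ∉ S → x j - x0 j = 0 := by
      intro j hj
      have : x0 j = 0 := by
        by_contra h
        exact hj ((hS j).2 h)
      rw [hcon j hj, this, sub_zero]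
    have hsum : ∑ j : S, (x j.val - x0 j.val) • A.transpose j.val = 0 := by
      rw [Finset.sum_coe_sort S (fun j => (x j - x0 j) • A.transpose j),
        Finset.sum_subset (Finset.subset_univ S)
          (fun j _ hj => by rw [hz j hj, zero_smul])]
      have h1 : A.mulVec (x - x0) = 0 := by rw [Matrix.mulVec_sub, hx, hy, sub_self]
      rw [← h1]
      ext i
      simp [Matrix.mulVec, dotProduct, Finset.sum_apply, mul_comm]
    have hli := Fintype.linearIndependent_iff.1 hrank (fun j => x j.val - x0 j.val) hsum
    ext j
    by_cases hj : j ∈ S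
    · exact sub_eq_zero.1 (hli ⟨j, hj⟩)
    · exact sub_eq_zero.1 (hz j hj)
  obtain ⟨k, hk, hxk⟩ := hex
  refine Finset.sum_lt_sum (fun j _ => ?_) ⟨k, Finset.mem_univ k, ?_⟩
  · refine (le_abs_self _).trans ?_
    rw [abs_mul]
    exact mul_le_of_le_one_left (abs_nonneg _) (hw j)
  · refine (le_abs_self _).trans_lt ?_
    rw [abs_mul]
    exact mul_lt_of_lt_one_left (abs_pos.2 hxk) (hc2 k hk)
end

section
/- Let x0 ∈ ℝ^n satisfy A x0 = y, with support S of size m, nonzero-entry vector x_opt ∈ ℝ^m, and corresponding column submatrix A_opt of A. Suppose A_opt has linearly independent columns, and let c = (A_opt†)ᵀ sign(x_opt), where A_opt† = (A_optᵀ A_opt)⁻¹ A_optᵀ. If |a_jᵀ c| < 1 for every column a_j of A with index outside S, then x0 is the unique minimizer of ‖x‖₁ over {x ∈ ℝ^n : A x = y}. -/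
open Matrix

/-- The `d × m` submatrix of `A` formed by the columns indexed by `S`. -/
def subCols {d n : ℕ} (A : Matrix (Fin d) (Fin n) ℝ) (S : Finset (Fin n)) :
    Matrix (Fin d) S ℝ :=
  Matrix.of fun i (j : S) => A i j.val

/-- The Moore–Penrose pseudoinverse `A_opt† = (A_optᵀ A_opt)⁻¹ A_optᵀ` of the
submatrix of columns of `A` indexed by `S` (valid when those columns are linearly
independent). -/
noncomputable def pinvCols {d n : ℕ} (A : Matrix (Fin d) (Fin n) ℝ) (S : Finset (Fin n)) :
    Matrix S (Fin d) ℝ :=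
  ((subCols A S).transpose * subCols A S)⁻¹ * (subCols A S).transpose

/-- **Fuchs Corollary.** Let `A x0 = y` with support `S` of size `m`, and suppose the columns
of `A` indexed by `S` are linearly independent. Let `c = (A_opt†)ᵀ sign(x_opt)`. If
`|a_jᵀ c| < 1` for every `j ∉ S`, then `x0` is the unique minimizer of `‖x‖₁` over
`{x : A x = y}`. -/
theorem fuchs_corollary {d n : ℕ} (A : Matrix (Fin d) (Fin n) ℝ) (y : Fin d → ℝ)
    (x0 : Fin n → ℝ) (S : Finset (Fin n)) (m : ℕ)
    (hS : ∀ i, i ∈ S ↔ x0 i ≠ 0) (hcard : S.card = m)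
    (hy : A.mulVec x0 = y)
    (hrank : LinearIndependent ℝ (fun j : S => A.transpose j.val))
    (hc : ∀ j ∉ S,
      |A.transpose j ⬝ᵥ (pinvCols A S).transpose.mulVec (fun j : S => Real.sign (x0 j.val))| < 1) :
    ∀ x : Fin n → ℝ, A.mulVec x = y → x ≠ x0 → ∑ i, |x0 i| < ∑ i, |x i| := by
  intro x hx hne
  have hinj : Function.Injective (subCols A S).mulVec := by
    rw [Matrix.mulVec_injective_iff]
    exact hrank
  have hG : IsUnit ((subCols A S).transpose * subCols A S) := by
    rw [← Matrix.mulVec_injective_iff_isUnit]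
    intro u v huv
    apply hinj
    have h1 : ((subCols A S).transpose * subCols A S).mulVec (u - v) = 0 := by
      rw [Matrix.mulVec_sub]; exact sub_eq_zero.2 huv
    have h2 : (subCols A S).mulVec (u - v) = 0 := by
      rw [← dotProduct_self_eq_zero]
      have h3 : (u - v) ⬝ᵥ ((subCols A S).transpose * subCols A S).mulVec (u - v) = 0 := by
        rw [h1, dotProduct_zero]
      rwa [← Matrix.mulVec_mulVec, Matrix.dotProduct_mulVec, Matrix.vecMul_transpose] at h3
    rw [Matrix.mulVec_sub] at h2
    exact sub_eq_zero.1 h2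
  set s : S → ℝ := fun j : S => Real.sign (x0 j.val) with hs
  set c := (pinvCols A S).transpose.mulVec s with hcdef
  have hBc : (subCols A S).transpose.mulVec c = s := by
    rw [hcdef, pinvCols, Matrix.transpose_mul, Matrix.transpose_transpose, Matrix.mulVec_mulVec,
      ← Matrix.mul_assoc, Matrix.transpose_nonsing_inv, Matrix.transpose_mul,
      Matrix.transpose_transpose, Matrix.mul_nonsing_inv _ ((Matrix.isUnit_iff_isUnit_det _).1 hG),
      Matrix.one_mulVec]
  have hin : ∀ j ∈ S, A.transpose j ⬝ᵥ c = Real.sign (x0 j) := by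
    intro j hj
    exact congrFun hBc ⟨j, hj⟩
  have hsum : ∀ z : Fin n → ℝ, A.mulVec z = y → ∑ i, (A.transpose i ⬝ᵥ c) * z i = c ⬝ᵥ y := by
    intro z hz
    rw [← hz, Matrix.dotProduct_mulVec, ← Matrix.mulVec_transpose]
    rfl
  have h0 : ∑ i, |x0 i| = c ⬝ᵥ y := by
    rw [← hsum x0 hy]
    refine Finset.sum_congr rfl fun i _ => ?_
    by_cases hi : i ∈ S
    · rw [hin i hi]
      rcases lt_trichotomy (x0 i) 0 with h | h | h
      · rw [Real.sign_of_neg h, abs_of_neg h]; ring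
      · simp [h]
      · rw [Real.sign_of_pos h, abs_of_pos h]; ring
    · have : x0 i = 0 := by
        by_contra h
        exact hi ((hS i).2 h)
      simp [this]
  have hle1 : ∀ i, |A.transpose i ⬝ᵥ c| ≤ 1 := by
    intro i
    by_cases hi : i ∈ S
    · rw [hin i hi]
      rcases Real.sign_apply_eq (x0 i) with h | h | h <;> simp [h]
    · exact (hc i hi).le
  have hle : ∀ i, (A.transpose i ⬝ᵥ c) * x i ≤ |x i| := by
    intro i
    calc _ ≤ |(A.transpose i ⬝ᵥ c) * x i| := le_abs_self _
      _ = |A.transpose i ⬝ᵥ c| * |x i| := abs_mul _ _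
      _ ≤ 1 * |x i| := mul_le_mul_of_nonneg_right (hle1 i) (abs_nonneg _)
      _ = _ := one_mul _
  rw [h0, ← hsum x hx]
  apply Finset.sum_lt_sum (fun i _ => hle i)
  by_contra hno
  push Not at hno
  apply hne
  have hout : ∀ i ∉ S, x i = 0 := by
    intro i hi
    by_contra hxi
    have h1 := hno i (Finset.mem_univ i)
    have h2 : (A.transpose i ⬝ᵥ c) * x i ≤ |A.transpose i ⬝ᵥ c| * |x i| := by
      rw [← abs_mul]; exact le_abs_self _
    have h3 := mul_lt_mul_of_pos_right (hc i hi) (abs_pos.2 hxi)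
    linarith
  have hout0 : ∀ i ∉ S, x0 i = 0 := fun i hi => by
    by_contra h
    exact hi ((hS i).2 h)
  have hres : ∀ z : Fin n → ℝ, (∀ i ∉ S, z i = 0) →
      (subCols A S).mulVec (fun j : S => z j.val) = A.mulVec z := by
    intro z hz
    ext k
    change ∑ j : S, A k j.val * z j.val = ∑ j, A k j * z j
    rw [Finset.sum_coe_sort S (fun j => A k j * z j)]
    exact Finset.sum_subset (Finset.subset_univ S) (fun i _ hi => by rw [hz i hi, mul_zero])
  have heq := hinj ((hres x hout).trans ((hx.trans hy.symm).trans (hres x0 hout0).symm))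
  ext i
  by_cases hi : i ∈ S
  · exact congrFun heq ⟨i, hi⟩
  · rw [hout i hi, hout0 i hi]
end

section
/- Let x0 ∈ ℝ^n satisfy A x0 = y, with support S of size m and corresponding column submatrix A_opt of A having linearly independent columns, and let A_opt† = (A_optᵀ A_opt)⁻¹ A_optᵀ. If ‖A_opt† a_j‖₁ < 1 for every column a_j of A with index outside S (the Exact Recovery Condition), then x0 is the unique minimizer of ‖x‖₁ over {x ∈ ℝ^n : A x = y}. -/
open Matrix

theorem pinv_left {d n : ℕ} (A : Matrix (Fin d) (Fin n) ℝ) (S : Finset (Fin n))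
    (hrank : LinearIndependent ℝ (fun j : S => A.transpose j.val)) :
    pinvCols A S * subCols A S = 1 := by
  have hinj : Function.Injective (subCols A S).mulVec := by
    rw [Matrix.mulVec_injective_iff]
    exact hrank
  have hpd := Matrix.PosDef.conjTranspose_mul_self (subCols A S) hinj
  rw [Matrix.conjTranspose_eq_transpose_of_trivial] at hpd
  have hu := (Matrix.isUnit_iff_isUnit_det _).1 hpd.isUnit
  unfold pinvCols
  rw [Matrix.mul_assoc, Matrix.nonsing_inv_mul _ hu]

theorem pinv_col {d n : ℕ} (A : Matrix (Fin d) (Fin n) ℝ) (S : Finset (Fin n))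
    (hrank : LinearIndependent ℝ (fun j : S => A.transpose j.val)) (i j : S) :
    (pinvCols A S).mulVec (A.transpose j.val) i = if i = j then 1 else 0 := by
  have h := congrFun (congrFun (pinv_left A S hrank) i) j
  rw [Matrix.one_apply] at h
  rw [← h]
  rfl

theorem pinv_sum {d n : ℕ} (A : Matrix (Fin d) (Fin n) ℝ) (S : Finset (Fin n))
    (hrank : LinearIndependent ℝ (fun j : S => A.transpose j.val)) (x : Fin n → ℝ) (i : S) :
    (pinvCols A S).mulVec (A.mulVec x) i
      = x i + ∑ j ∈ Sᶜ, (pinvCols A S).mulVec (A.transpose j) i * x j := by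
  have h1 : (pinvCols A S).mulVec (A.mulVec x) i
      = ∑ j, (pinvCols A S).mulVec (A.transpose j) i * x j := by
    rw [Matrix.mulVec_mulVec]
    rfl
  rw [h1, ← Finset.sum_add_sum_compl S]
  congr 1
  rw [← Finset.sum_coe_sort]
  simp only [pinv_col A S hrank]
  simp

/-- **Exact Recovery Condition (Tropp).** Let `A x0 = y` with support `S` of size `m`, and
suppose the columns of `A` indexed by `S` are linearly independent. If
`‖A_opt† a_j‖₁ < 1` for every column `a_j` of `A` with index outside `S`, then `x0` is the
unique minimizer of `‖x‖₁` over `{x : A x = y}`. -/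
theorem exact_recovery_condition {d n : ℕ} (A : Matrix (Fin d) (Fin n) ℝ) (y : Fin d → ℝ)
    (x0 : Fin n → ℝ) (S : Finset (Fin n)) (m : ℕ)
    (hS : ∀ i, i ∈ S ↔ x0 i ≠ 0) (hcard : S.card = m)
    (hy : A.mulVec x0 = y)
    (hrank : LinearIndependent ℝ (fun j : S => A.transpose j.val))
    (herc : ∀ j ∉ S, ∑ i : S, |(pinvCols A S).mulVec (A.transpose j) i| < 1) :
    ∀ x : Fin n → ℝ, A.mulVec x = y → x ≠ x0 → ∑ i, |x0 i| < ∑ i, |x i| := by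
  intro x hx hne
  have key : ∀ i : S, x0 i
      = x i + ∑ j ∈ Sᶜ, (pinvCols A S).mulVec (A.transpose j) i * x j := by
    intro i
    have h1 := pinv_sum A S hrank x i
    have h0 := pinv_sum A S hrank x0 i
    have hz : ∑ j ∈ Sᶜ, (pinvCols A S).mulVec (A.transpose j) i * x0 j = 0 := by
      apply Finset.sum_eq_zero
      intro j hj
      have : x0 j = 0 := by
        by_contra h
        exact (Finset.mem_compl.1 hj) ((hS j).2 h)
      rw [this, mul_zero]
    rw [hx, ← hy] at h1
    linarith
  have hx0 : ∀ j ∉ S, x0 j = 0 := by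
    intro j hj
    by_contra h
    exact hj ((hS j).2 h)
  have hex : ∃ j ∈ Sᶜ, x j ≠ 0 := by
    by_contra! hc
    apply hne
    funext j
    by_cases hj : j ∈ S
    · have := key ⟨j, hj⟩
      rw [Finset.sum_eq_zero (fun k hk => by rw [hc k hk, mul_zero])] at this
      simpa using this.symm
    · rw [hx0 j hj, hc j (Finset.mem_compl.2 hj)]
  rw [← Finset.sum_add_sum_compl S, ← Finset.sum_add_sum_compl S (fun i => |x i|),
    Finset.sum_eq_zero (s := Sᶜ) (f := fun i => |x0 i|)
      (fun j hj => by rw [hx0 j (Finset.mem_compl.1 hj), abs_zero]), add_zero]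
  have hle : ∑ i ∈ S, |x0 i| ≤ ∑ i ∈ S, |x i| +
      ∑ j ∈ Sᶜ, (∑ i : S, |(pinvCols A S).mulVec (A.transpose j) i|) * |x j| := by
    rw [← Finset.sum_coe_sort S, ← Finset.sum_coe_sort S (fun i => |x i|)]
    simp only [Finset.sum_mul]
    rw [Finset.sum_comm, ← Finset.sum_add_distrib]
    apply Finset.sum_le_sum
    intro i _
    rw [key i]
    refine (abs_add_le _ _).trans ?_
    gcongr
    refine (Finset.abs_sum_le_sum_abs _ _).trans ?_
    simp only [abs_mul]
    exact le_rfl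
  refine hle.trans_lt ?_
  gcongr 1
  obtain ⟨k, hk, hk0⟩ := hex
  apply Finset.sum_lt_sum
  · intro j hj
    have := (herc j (Finset.mem_compl.1 hj)).le
    nlinarith [abs_nonneg (x j)]
  · refine ⟨k, hk, ?_⟩
    have := herc k (Finset.mem_compl.1 hk)
    nlinarith [abs_pos.2 hk0]
end

section
/- Let x̃0 ∈ ℝ^{2n} satisfy x̃0 ≥ 0 and Ã x̃0 = y, let S be the support of x̃0 with |S| = m, and let Ã_opt be the d×m submatrix of the columns of Ã indexed by S. Then x̃0 is the unique minimizer of 1ᵀx̃ over {x̃ ∈ ℝ^{2n} : Ã x̃ = y, x̃ ≥ 0} if and only if Ã_opt has linearly independent columns and there exists c ∈ ℝ^d such that ã_jᵀ c = 1 for every j ∈ S and ã_jᵀ c < 1 for every j ∉ S, where ã_j denotes the j-th column of Ã. -/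
open Matrix

/-- The doubled matrix `Ã = [A, −A]`, whose columns are the atoms `a_j` followed by their
negatives `−a_j`. -/
def doubled {d n : ℕ} (A : Matrix (Fin d) (Fin n) ℝ) : Matrix (Fin d) (Fin n ⊕ Fin n) ℝ :=
  Matrix.of fun i => Sum.elim (fun j => A i j) (fun j => -A i j)

theorem aux_dir {d : ℕ} {J : Type} [Fintype J] (B : Matrix (Fin d) J ℝ)
    (x0 : J → ℝ) (S : Finset J) (hpos : ∀ j, 0 ≤ x0 j) (hS : ∀ j, j ∈ S ↔ x0 j ≠ 0)
    (H : ∀ x : J → ℝ, (∀ j, 0 ≤ x j) → B.mulVec x = B.mulVec x0 → x ≠ x0 →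
        ∑ j, x0 j < ∑ j, x j) (h : J → ℝ) (hB : B.mulVec h = 0)
    (hn : ∀ j ∉ S, 0 ≤ h j) (h0 : h ≠ 0) : 0 < ∑ j, h j := by
  have ev : ∀ᶠ t : ℝ in nhdsWithin 0 (Set.Ioi 0), ∀ j, 0 ≤ x0 j + t * h j := by
    rw [Filter.eventually_all]
    intro j
    by_cases hj : j ∈ S
    · have hp : 0 < x0 j := lt_of_le_of_ne (hpos j) (Ne.symm ((hS j).1 hj))
      have hc : ContinuousAt (fun t : ℝ => x0 j + t * h j) 0 := by fun_prop
      have : ∀ᶠ t : ℝ in nhds 0, 0 < x0 j + t * h j :=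
        hc.eventually (lt_mem_nhds (by simpa using hp))
      exact (this.filter_mono nhdsWithin_le_nhds).mono fun t ht => ht.le
    · filter_upwards [self_mem_nhdsWithin] with t ht
      have := mul_nonneg (le_of_lt (Set.mem_Ioi.1 ht)) (hn j hj)
      linarith [hpos j]
  obtain ⟨t, ht, htp⟩ := (ev.and self_mem_nhdsWithin).exists
  have htp : 0 < t := htp
  have := H (x0 + t • h) (by simpa using ht) (by rw [mulVec_add, mulVec_smul, hB]; simp)
    (by simpa using ⟨htp.ne', h0⟩)
  simp only [Pi.add_apply, Pi.smul_apply, smul_eq_mul, Finset.sum_add_distrib,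
    ← Finset.mul_sum] at this
  have h2 : 0 < t * ∑ j, h j := by linarith
  exact (mul_pos_iff_of_pos_left htp).1 h2

theorem aux_li {d : ℕ} {J : Type} [Fintype J] (B : Matrix (Fin d) J ℝ) (S : Finset J)
    (H : ∀ h : J → ℝ, B.mulVec h = 0 → (∀ j ∉ S, 0 ≤ h j) → h ≠ 0 → 0 < ∑ j, h j) :
    LinearIndependent ℝ (fun j : S => B.transpose j.val) := by
  classical
  rw [Fintype.linearIndependent_iff]
  intro g hg
  set h : J → ℝ := fun j => if hj : j ∈ S then g ⟨j, hj⟩ else 0 with hh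
  have hB : B.mulVec h = 0 := by
    ext i
    have := congrFun hg i
    simp only [Finset.sum_apply, Pi.smul_apply, transpose_apply, smul_eq_mul, Pi.zero_apply] at this
    rw [mulVec, dotProduct, Pi.zero_apply, ← this,
      ← Finset.sum_subset (Finset.subset_univ S), ← Finset.sum_coe_sort S]
    · refine Finset.sum_congr rfl fun j _ => ?_
      simp [hh, mul_comm]
    · intro j _ hj
      simp [hh, hj]
  have hz : h = 0 := by
    by_contra h0
    have h1 := H h hB (fun j hj => by simp [hh, hj]) h0
    have h2 := H (-h) (by rw [mulVec_neg, hB, neg_zero]) (fun j hj => by simp [hh, hj])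
      (by simpa using h0)
    simp only [Pi.neg_apply, Finset.sum_neg_distrib] at h2
    linarith
  intro i
  have := congrFun hz i.1
  simpa [hh] using this

theorem aux_c {d : ℕ} {J : Type} [Fintype J] (B : Matrix (Fin d) J ℝ) (S : Finset J)
    (H : ∀ h : J → ℝ, B.mulVec h = 0 → (∀ j ∉ S, 0 ≤ h j) → h ≠ 0 → 0 < ∑ j, h j) :
    ∃ c : Fin d → ℝ, (∀ j ∈ S, B.transpose j ⬝ᵥ c = 1) ∧ (∀ j ∉ S, B.transpose j ⬝ᵥ c < 1) := by
  classical
  let v : J → (Fin d → ℝ) × ℝ := fun j => (B.transpose j, -1)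
  let w : Option J → (Fin d → ℝ) × ℝ := fun o =>
    o.elim (0, -1) (fun j => if j ∈ S then (0, -1) else v j)
  let T := Fintype.linearCombination ℝ w
  let L := Fintype.linearCombination ℝ (fun j => if j ∈ S then v j else 0)
  have hcT : Continuous T := T.continuous_of_finiteDimensional
  obtain ⟨f, u, r, hf1, hur, hf2⟩ := geometric_hahn_banach_compact_closed
    (s := T '' stdSimplex ℝ (Option J)) (t := (LinearMap.range L : Set _))
    ((convex_stdSimplex ℝ _).linear_image T) ((isCompact_stdSimplex ℝ _).image hcT)
    (LinearMap.range L).convex (LinearMap.range L).closed_of_finiteDimensional (by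
      rw [Set.disjoint_left]
      rintro _ ⟨l, ⟨hl0, hl1⟩, rfl⟩ ⟨g, hg⟩
      rw [Fintype.sum_option] at hl1
      simp only [L, T, Fintype.linearCombination_apply, Fintype.sum_option] at hg
      set h : J → ℝ := fun j => if j ∈ S then -g j else l (some j) with hh
      have e1 : B.mulVec h = 0 := by
        ext i
        have := congrFun (congrArg Prod.fst hg) i
        simp only [w, v, Prod.fst_sum, Prod.fst_add, Pi.add_apply, Finset.sum_apply, Prod.smul_fst,
          Option.elim, Pi.smul_apply, apply_ite Prod.fst, ite_apply, transpose_apply,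
          smul_eq_mul, Pi.zero_apply, Prod.fst_zero, mul_zero, zero_add] at this
        rw [← sub_eq_zero, ← Finset.sum_sub_distrib] at this
        rw [mulVec, dotProduct, Pi.zero_apply, ← neg_eq_zero, ← this, ← Finset.sum_neg_distrib]
        refine Finset.sum_congr rfl fun j _ => ?_
        by_cases hj : j ∈ S <;> simp [hh, hj, mul_comm]
      have e2 : ∑ j, h j = - (l none + ∑ j, if j ∈ S then l (some j) else 0) := by
        have := congrArg Prod.snd hg
        simp only [w, v, Prod.snd_sum, Prod.snd_add, Prod.smul_snd,
          Option.elim, apply_ite Prod.snd, ite_self,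
          smul_eq_mul, Prod.snd_zero] at this
        have e3 : ∑ j, h j = ∑ j, g j * (if j ∈ S then -1 else 0)
            + ∑ j, l (some j) - ∑ j, if j ∈ S then l (some j) else 0 := by
          rw [← Finset.sum_add_distrib, ← Finset.sum_sub_distrib]
          refine Finset.sum_congr rfl fun j _ => ?_
          by_cases hj : j ∈ S <;> simp [hh, hj]
        rw [e3, this, ← Finset.sum_mul]
        ring
      have e4 : 0 ≤ ∑ j, if j ∈ S then l (some j) else 0 :=
        Finset.sum_nonneg fun j _ => by split_ifs <;> simp [hl0]
      have e5 := hl0 none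
      have hz : h = 0 := by
        by_contra h0
        have := H h e1 (fun j hj => by simp [hh, hj, hl0]) h0
        linarith
      have e6 : ∑ j, l (some j) = ∑ j, if j ∈ S then l (some j) else 0 := by
        refine Finset.sum_congr rfl fun j _ => ?_
        have := congrFun hz j
        by_cases hj : j ∈ S
        · simp [hj]
        · simpa [hh, hj] using this
      simp only [hz, Pi.zero_apply, Finset.sum_const_zero] at e2
      linarith)
  have hr : r < 0 := by simpa using hf2 0 (Submodule.zero_mem _)
  have hw : ∀ o, f (w o) < 0 := by
    intro o
    have := hf1 (w o) ⟨Pi.single o 1, single_mem_stdSimplex ℝ o, by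
      simp [T]⟩
    linarith
  have hV : ∀ j ∈ S, f (v j) = 0 := by
    intro j hj
    by_contra hne
    have := hf2 (L (Pi.single j (r / f (v j)))) ⟨_, rfl⟩
    simp [L, hj, hne] at this
  have hs : 0 < f (0, 1) := by
    have h1 := hw none
    have : w none = -((0, 1) : (Fin d → ℝ) × ℝ) := by simp [w]
    rw [this, map_neg] at h1
    linarith
  have hfv : ∀ j, f (v j) = B.transpose j ⬝ᵥ (fun i => f (Pi.single i 1, 0)) - f (0, 1) := by
    intro j
    have : v j = ∑ i, B i j • ((Pi.single i 1, 0) : (Fin d → ℝ) × ℝ) - (0, 1) := by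
      ext i
      · simp [v, Prod.fst_sum, Finset.sum_apply, Pi.single_apply]
      · simp [v, Prod.snd_sum]
    rw [this, map_sub, map_sum]
    simp only [map_smul, dotProduct, transpose_apply, smul_eq_mul]
  refine ⟨(f (0, 1))⁻¹ • (fun i => f (Pi.single i 1, 0)), fun j hj => ?_, fun j hj => ?_⟩
  · have := hV j hj
    rw [hfv] at this
    rw [dotProduct_smul, sub_eq_zero.1 this, smul_eq_mul, inv_mul_cancel₀ hs.ne']
  · have := hw (some j)
    simp only [w, Option.elim, hj, if_false] at this
    rw [hfv] at this
    rw [dotProduct_smul, smul_eq_mul, inv_mul_lt_iff₀ hs]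
    linarith

theorem aux_rev {d : ℕ} {J : Type} [Fintype J] (B : Matrix (Fin d) J ℝ)
    (x0 : J → ℝ) (S : Finset J) (hS : ∀ j, j ∈ S ↔ x0 j ≠ 0)
    (hli : LinearIndependent ℝ (fun j : S => B.transpose j.val)) (c : Fin d → ℝ)
    (hc1 : ∀ j ∈ S, B.transpose j ⬝ᵥ c = 1) (hc2 : ∀ j ∉ S, B.transpose j ⬝ᵥ c < 1)
    (x : J → ℝ) (hx : ∀ j, 0 ≤ x j) (hB : B.mulVec x = B.mulVec x0) (hne : x ≠ x0) :
    ∑ j, x0 j < ∑ j, x j := by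
  classical
  have key : ∀ z : J → ℝ, B.mulVec z ⬝ᵥ c = ∑ j, z j * (B.transpose j ⬝ᵥ c) := by
    intro z
    simp only [mulVec, dotProduct, transpose_apply, Finset.sum_mul, Finset.mul_sum]
    rw [Finset.sum_comm]
    refine Finset.sum_congr rfl fun j _ => Finset.sum_congr rfl fun i _ => by ring
  have h0 : ∑ j, x0 j = ∑ j, x j * (B.transpose j ⬝ᵥ c) := by
    rw [← key, hB, key]
    refine Finset.sum_congr rfl fun j _ => ?_
    by_cases hj : j ∈ S
    · rw [hc1 j hj, mul_one]
    · have : x0 j = 0 := by simpa [hj] using hS j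
      simp [this]
  rw [h0]
  have hle : ∀ j, B.transpose j ⬝ᵥ c ≤ 1 := fun j => by
    by_cases hj : j ∈ S
    · exact (hc1 j hj).le
    · exact (hc2 j hj).le
  refine Finset.sum_lt_sum (fun j _ => mul_le_of_le_one_right (hx j) (hle j)) ?_
  by_contra hcon
  push Not at hcon
  have hz : ∀ j ∉ S, x j = 0 := by
    intro j hj
    by_contra hxj
    have hp := lt_of_le_of_ne (hx j) (Ne.symm hxj)
    have := hcon j (Finset.mem_univ _)
    nlinarith [hc2 j hj]
  have hz0 : ∀ j ∉ S, x0 j = 0 := fun j hj => by simpa [hj] using hS j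
  rw [Fintype.linearIndependent_iff] at hli
  have := hli (fun j => x j - x0 j) (by
    ext i
    have hi := congrFun hB i
    simp only [mulVec, dotProduct] at hi
    rw [← sub_eq_zero, ← Finset.sum_sub_distrib,
      ← Finset.sum_subset (Finset.subset_univ S), ← Finset.sum_coe_sort S] at hi
    · simp only [Finset.sum_apply, Pi.smul_apply, transpose_apply, smul_eq_mul, Pi.zero_apply]
      rw [← hi]
      refine Finset.sum_congr rfl fun j _ => by ring
    · intro j _ hj
      simp [hz j hj, hz0 j hj])
  apply hne
  ext j
  by_cases hj : j ∈ S
  · exact sub_eq_zero.1 (this ⟨j, hj⟩)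
  · rw [hz j hj, hz0 j hj]

/-- **Fuchs Condition in standard form.** Let `x̃0 ≥ 0` satisfy `Ã x̃0 = y`, with support `S`
of size `m`. Then `x̃0` is the unique minimizer of `1ᵀ x̃` over `{x̃ ≥ 0 : Ã x̃ = y}` if and
only if the columns of `Ã` indexed by `S` are linearly independent and there exists `c` with
`ã_jᵀ c = 1` for every `j ∈ S` and `ã_jᵀ c < 1` for every `j ∉ S`. -/
theorem fuchs_standard_form {d n : ℕ} (A : Matrix (Fin d) (Fin n) ℝ) (y : Fin d → ℝ)
    (xt0 : Fin n ⊕ Fin n → ℝ) (S : Finset (Fin n ⊕ Fin n)) (m : ℕ)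
    (hpos : ∀ j, 0 ≤ xt0 j)
    (hy : (doubled A).mulVec xt0 = y)
    (hS : ∀ j, j ∈ S ↔ xt0 j ≠ 0) (hcard : S.card = m) :
    (∀ xt : Fin n ⊕ Fin n → ℝ, (∀ j, 0 ≤ xt j) → (doubled A).mulVec xt = y → xt ≠ xt0 →
        ∑ j, xt0 j < ∑ j, xt j) ↔
      (LinearIndependent ℝ (fun j : S => (doubled A).transpose j.val) ∧
        ∃ c : Fin d → ℝ,
          (∀ j ∈ S, (doubled A).transpose j ⬝ᵥ c = 1) ∧
          (∀ j ∉ S, (doubled A).transpose j ⬝ᵥ c < 1)) := by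
  subst hy
  constructor
  · intro H
    have H' := aux_dir (doubled A) xt0 S hpos hS H
    exact ⟨aux_li _ S H', aux_c _ S H'⟩
  · rintro ⟨hli, c, h1, h2⟩ x hx hB hne
    exact aux_rev _ xt0 S hS hli c h1 h2 x hx hB hne
end

section
/- Let x0 ∈ ℝ^n satisfy A x0 = y, with support S of size m, nonzero-entry vector x_opt ∈ ℝ^m, and corresponding column submatrix A_opt of A. Then x0 is the unique minimizer of ‖x‖₁ over {x ∈ ℝ^n : A x = y} if and only if A_opt has linearly independent columns and there exists c ∈ ℝ^d such that A_optᵀ c = sign(x_opt) and |a_jᵀ c| < 1 for every column a_j of A with index outside S. (In particular the Fuchs condition is both necessary and sufficient for ℓ1-unique-optimality.) -/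
open Matrix

lemma fuchs_abs_add (a b : ℝ) (ha : a ≠ 0) (h : |b| ≤ |a|) :
    |a + b| = |a| + Real.sign a * b := by
  rcases lt_or_gt_of_ne ha with h0 | h0
  · rw [Real.sign_of_neg h0]
    rw [abs_of_neg h0] at *
    have := abs_le.1 h
    rw [abs_of_nonpos (by linarith)]; ring
  · rw [Real.sign_of_pos h0]
    rw [abs_of_pos h0] at *
    have := abs_le.1 h
    rw [abs_of_nonneg (by linarith)]; ring

lemma fuchs_sign_mul (a : ℝ) : Real.sign a * a = |a| := by
  rcases lt_trichotomy a 0 with h0 | h0 | h0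
  · rw [Real.sign_of_neg h0, abs_of_neg h0]; ring
  · simp [h0]
  · rw [Real.sign_of_pos h0, abs_of_pos h0]; ring

lemma fuchs_abs_sign (a : ℝ) : |Real.sign a| ≤ 1 := by
  rcases Real.sign_apply_eq a with h | h | h <;> simp [h]

lemma fuchs_step {n : ℕ} (S : Finset (Fin n)) (x h : Fin n → ℝ) (hS : ∀ i ∈ S, x i ≠ 0) :
    ∃ t : ℝ, 0 < t ∧ ∀ i ∈ S, |t * h i| ≤ |x i| := by
  have : ∀ᶠ t : ℝ in nhdsWithin 0 (Set.Ioi 0), ∀ i ∈ S, |t * h i| ≤ |x i| := by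
    rw [Filter.eventually_all_finset]
    intro i hi
    apply Filter.Eventually.filter_mono nhdsWithin_le_nhds
    have hc : Filter.Tendsto (fun t : ℝ => |t * h i|) (nhds 0) (nhds |0 * h i|) :=
      Continuous.tendsto (by fun_prop) 0
    have hp : |0 * h i| < |x i| := by simpa using hS i hi
    filter_upwards [hc.eventually (gt_mem_nhds hp)] with t ht using le_of_lt ht
  obtain ⟨t, ht, hp⟩ := (this.and self_mem_nhdsWithin).exists
  exact ⟨t, hp, ht⟩

lemma fuchs_dot {d n : ℕ} (A : Matrix (Fin d) (Fin n) ℝ) (c : Fin d → ℝ) (x : Fin n → ℝ) :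
    ∑ j, (A.transpose j ⬝ᵥ c) * x j = c ⬝ᵥ A.mulVec x := by
  rw [Matrix.dotProduct_mulVec]
  simp only [dotProduct, Matrix.vecMul, Matrix.transpose_apply]
  refine Finset.sum_congr rfl fun j _ => ?_
  congr 1
  exact Finset.sum_congr rfl fun i _ => mul_comm _ _

lemma fuchs_li {d n : ℕ} (A : Matrix (Fin d) (Fin n) ℝ) (S : Finset (Fin n)) :
    LinearIndependent ℝ (fun j : S => A.transpose j.val) ↔
      ∀ h : Fin n → ℝ, A.mulVec h = 0 → (∀ i ∉ S, h i = 0) → h = 0 := by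
  rw [Fintype.linearIndependent_iff]
  have key : ∀ h : Fin n → ℝ, (∀ i ∉ S, h i = 0) →
      A.mulVec h = ∑ j : S, h j.val • A.transpose j.val := by
    intro h hh
    ext k
    rw [Finset.sum_coe_sort S (fun j => h j • A.transpose j)]
    simp only [Matrix.mulVec, dotProduct, Finset.sum_apply, Pi.smul_apply, smul_eq_mul,
      Matrix.transpose_apply]
    rw [← Finset.sum_subset (Finset.subset_univ S)]
    · exact Finset.sum_congr rfl fun i _ => mul_comm _ _
    · intro i _ hi
      simp [hh i hi]
  constructor
  · intro H h h0 hh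
    rw [key h hh] at h0
    have := H (fun j => h j.val) h0
    ext i
    by_cases hi : i ∈ S
    · exact this ⟨i, hi⟩
    · exact hh i hi
  · intro H g hg i
    have hh : ∀ i ∉ S, (fun i => if hi : i ∈ S then g ⟨i, hi⟩ else 0) i = 0 := by
      intro i hi; simp [hi]
    have := H (fun i => if hi : i ∈ S then g ⟨i, hi⟩ else 0) (by
      rw [key _ hh, ← hg]
      refine Finset.sum_congr rfl fun j _ => ?_
      simp) hh
    have := congrFun this i.val
    simpa using this

lemma fuchs_exists {d n : ℕ} (A : Matrix (Fin d) (Fin n) ℝ) (s : Fin n → ℝ) (S : Finset (Fin n))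
    (hq : ∀ h : Fin n → ℝ, A.mulVec h = 0 → h ≠ 0 →
      0 < ∑ i, (if i ∈ S then s i * h i else |h i|)) :
    ∃ c : Fin d → ℝ, (∀ j ∈ S, A.transpose j ⬝ᵥ c = s j) ∧
          (∀ j ∉ S, |A.transpose j ⬝ᵥ c| < 1) := by
  -- compactness
  have hqc : Continuous (fun h : Fin n → ℝ => ∑ i, (if i ∈ S then s i * h i else |h i|)) := by
    refine continuous_finset_sum _ fun i _ => ?_
    split_ifs <;> fun_prop
  have hcl : IsClosed {h : Fin n → ℝ | A.mulVec h = 0} :=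
    isClosed_eq (Continuous.matrix_mulVec continuous_const continuous_id) continuous_const
  have hK : IsCompact (Metric.sphere (0 : Fin n → ℝ) 1 ∩ {h | A.mulVec h = 0}) :=
    (isCompact_sphere _ _).inter_right hcl
  obtain ⟨ε, hε, hmin⟩ := hK.exists_forall_le' hqc.continuousOn (a := 0) (by
    rintro h ⟨h1, h2⟩
    refine hq h h2 ?_
    rintro rfl
    simp at h1)
  have hmin' : ∀ h : Fin n → ℝ, A.mulVec h = 0 → h ≠ 0 →
      ε * ‖h‖ ≤ ∑ i, (if i ∈ S then s i * h i else |h i|) := by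
    intro h h0 hne
    have hp : 0 < ‖h‖ := norm_pos_iff.2 hne
    have := hmin (‖h‖⁻¹ • h) ⟨by simp [norm_smul, hp.ne'], by
      simp [Matrix.mulVec_smul, h0]⟩
    have e : ∑ i, (if i ∈ S then s i * (‖h‖⁻¹ • h) i else |(‖h‖⁻¹ • h) i|)
        = ‖h‖⁻¹ * ∑ i, (if i ∈ S then s i * h i else |h i|) := by
      rw [Finset.mul_sum]
      refine Finset.sum_congr rfl fun i _ => ?_
      split_ifs
      · simp; ring
      · simp [abs_mul]
    rw [e, inv_mul_eq_div, le_div_iff₀ hp] at this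
    exact this
  obtain ⟨δ, hδ0, hδ1, hδn⟩ : ∃ δ : ℝ, 0 < δ ∧ δ ≤ 1 ∧ δ * n < ε := by
    refine ⟨min 1 (ε / (n + 1)), by positivity, min_le_left _ _, ?_⟩
    have h1 : min 1 (ε / (n + 1)) ≤ ε / ((n : ℝ) + 1) := min_le_right _ _
    have h2 : 0 < min 1 (ε / ((n : ℝ) + 1)) := by positivity
    rw [le_div_iff₀ (by positivity)] at h1
    nlinarith
  have hr : ∀ h : Fin n → ℝ, A.mulVec h = 0 → h ≠ 0 →
      0 < ∑ i, (if i ∈ S then s i * h i else (1 - δ) * |h i|) := by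
    intro h h0 hne
    have hp : 0 < ‖h‖ := norm_pos_iff.2 hne
    have h1 := hmin' h h0 hne
    have h2 : ∑ i, (if i ∈ S then s i * h i else |h i|) - ∑ _i : Fin n, δ * ‖h‖ ≤
        ∑ i, (if i ∈ S then s i * h i else (1 - δ) * |h i|) := by
      rw [← Finset.sum_sub_distrib]
      refine Finset.sum_le_sum fun i _ => ?_
      have h3 : |h i| ≤ ‖h‖ := norm_le_pi_norm h i
      have h4 : 0 < δ * ‖h‖ := by positivity
      split_ifs
      · linarith
      · nlinarith
    simp only [Finset.sum_const, Finset.card_univ, Fintype.card_fin, nsmul_eq_mul] at h2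
    nlinarith
  set lo : Fin n → ℝ := fun i => if i ∈ S then s i else -(1 - δ) with hlo
  set hi : Fin n → ℝ := fun i => if i ∈ S then s i else (1 - δ) with hhi
  by_cases hd : Disjoint (Set.Icc lo hi) (LinearMap.range (Matrix.mulVecLin Aᵀ) : Set (Fin n → ℝ))
  · exfalso
    obtain ⟨f, u, v, hfu, huv, hfv⟩ := geometric_hahn_banach_compact_closed (convex_Icc lo hi)
      isCompact_Icc (Submodule.convex _) (Submodule.closed_of_finiteDimensional _) hd
    set h : Fin n → ℝ := fun i => f (Pi.single i 1) with hh
    have hf : ∀ w, f w = ∑ i, w i * h i := by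
      intro w
      conv_lhs => rw [pi_eq_sum_univ' w]
      simp [hh, map_sum]
    have hv0 : v < 0 := by simpa using hfv 0 (Submodule.zero_mem _)
    have hz : ∀ c : Fin d → ℝ, c ⬝ᵥ A.mulVec h = 0 := by
      intro c
      by_contra hne
      have h1 := hfv (Aᵀ.mulVec ((v / (c ⬝ᵥ A.mulVec h)) • c)) ⟨_, rfl⟩
      rw [hf] at h1
      have h2 := fuchs_dot A ((v / (c ⬝ᵥ A.mulVec h)) • c) h
      rw [smul_dotProduct, smul_eq_mul, div_mul_cancel₀ _ hne] at h2
      have h3 : ∑ i, (Aᵀ.mulVec ((v / (c ⬝ᵥ A.mulVec h)) • c)) i * h i = v := h2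
      linarith
    have hA : A.mulVec h = 0 := dotProduct_self_eq_zero.1 (hz _)
    have hw := hfu (fun i => if i ∈ S then s i else (1 - δ) * Real.sign (h i)) (by
      constructor <;> intro i <;> simp only [hlo, hhi] <;> split_ifs
      · exact le_rfl
      · have := abs_le.1 (fuchs_abs_sign (h i)); nlinarith
      · exact le_rfl
      · have := abs_le.1 (fuchs_abs_sign (h i)); nlinarith)
    rw [hf] at hw
    have e : ∑ i, (if i ∈ S then s i else (1 - δ) * Real.sign (h i)) * h i
        = ∑ i, (if i ∈ S then s i * h i else (1 - δ) * |h i|) := by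
      refine Finset.sum_congr rfl fun i _ => ?_
      split_ifs
      · rfl
      · rw [mul_assoc, fuchs_sign_mul]
    rw [e] at hw
    have hne : h ≠ 0 := by
      intro h0
      simp [h0] at hw
      linarith
    have := hr h hA hne
    linarith
  · obtain ⟨w, ⟨hw1, hw2⟩, ⟨c, rfl⟩⟩ := Set.not_disjoint_iff.1 hd
    refine ⟨c, fun j hj => ?_, fun j hj => ?_⟩
    · have h1 := hw1 j
      have h2 := hw2 j
      simp only [hlo, hhi, hj, if_true] at h1 h2
      exact le_antisymm h2 h1
    · have h1 := hw1 j
      have h2 := hw2 j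
      simp only [hlo, hhi, hj, if_false] at h1 h2
      have h3 : |Aᵀ j ⬝ᵥ c| ≤ 1 - δ := abs_le.2 ⟨h1, h2⟩
      linarith

/-- **The Fuchs Condition is necessary and sufficient for ℓ1-unique-optimality.** Let
`A x0 = y` with support `S` of size `m`. Then `x0` is the unique minimizer of `‖x‖₁` over
`{x : A x = y}` if and only if the columns of `A` indexed by `S` are linearly independent and
there exists `c ∈ ℝ^d` with `a_jᵀ c = sign(x0 j)` for `j ∈ S` and `|a_jᵀ c| < 1` for
`j ∉ S`. -/
theorem fuchs_necessary_and_sufficient {d n : ℕ} (A : Matrix (Fin d) (Fin n) ℝ)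
    (y : Fin d → ℝ) (x0 : Fin n → ℝ) (S : Finset (Fin n)) (m : ℕ)
    (hS : ∀ i, i ∈ S ↔ x0 i ≠ 0) (hcard : S.card = m)
    (hy : A.mulVec x0 = y) :
    (∀ x : Fin n → ℝ, A.mulVec x = y → x ≠ x0 → ∑ i, |x0 i| < ∑ i, |x i|) ↔
      (LinearIndependent ℝ (fun j : S => A.transpose j.val) ∧
        ∃ c : Fin d → ℝ,
          (∀ j ∈ S, A.transpose j ⬝ᵥ c = Real.sign (x0 j)) ∧
          (∀ j ∉ S, |A.transpose j ⬝ᵥ c| < 1)) := by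
  constructor
  · intro H
    have hq : ∀ h : Fin n → ℝ, A.mulVec h = 0 → h ≠ 0 →
        0 < ∑ i, (if i ∈ S then Real.sign (x0 i) * h i else |h i|) := by
      intro h h0 hne
      obtain ⟨t, ht, hts⟩ := fuchs_step S x0 h fun i hi => (hS i).1 hi
      have h1 := H (x0 + t • h) (by simp [Matrix.mulVec_add, Matrix.mulVec_smul, h0, hy])
        (by simp [ht.ne', hne])
      have e : ∑ i, |(x0 + t • h) i| = ∑ i, |x0 i| +
          t * ∑ i, (if i ∈ S then Real.sign (x0 i) * h i else |h i|) := by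
        rw [Finset.mul_sum, ← Finset.sum_add_distrib]
        refine Finset.sum_congr rfl fun i _ => ?_
        split_ifs with hi
        · simp only [Pi.add_apply, Pi.smul_apply, smul_eq_mul]
          rw [fuchs_abs_add _ _ ((hS i).1 hi) (hts i hi)]; ring
        · have hx : x0 i = 0 := by
            by_contra hx
            exact hi ((hS i).2 hx)
          simp [hx, abs_mul, abs_of_pos ht]
      rw [e] at h1
      exact pos_of_mul_pos_right (by linarith) ht.le
    refine ⟨(fuchs_li A S).2 ?_, fuchs_exists A _ S hq⟩
    intro h h0 hh
    by_contra hne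
    have h1 := hq h h0 hne
    have h2 := hq (-h) (by simp [Matrix.mulVec_neg, h0]) (by simpa using hne)
    have e : ∑ i, (if i ∈ S then Real.sign (x0 i) * (-h) i else |(-h) i|)
        = - ∑ i, (if i ∈ S then Real.sign (x0 i) * h i else |h i|) := by
      rw [← Finset.sum_neg_distrib]
      refine Finset.sum_congr rfl fun i _ => ?_
      split_ifs with hi
      · simp
      · simp [hh i hi]
    linarith
  · rintro ⟨hli, c, hc1, hc2⟩ x hx hne
    rw [fuchs_li] at hli
    have hx0 : ∀ i ∉ S, x0 i = 0 := by
      intro i hi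
      by_contra hx
      exact hi ((hS i).2 hx)
    obtain ⟨k, hk, hxk⟩ : ∃ k, k ∉ S ∧ x k ≠ 0 := by
      by_contra! hcon
      apply hne
      rw [← sub_eq_zero]
      refine hli _ (by rw [Matrix.mulVec_sub, hx, hy, sub_self]) fun i hi => ?_
      simp [hcon i hi, hx0 i hi]
    have hle : ∀ j, |Aᵀ j ⬝ᵥ c| ≤ 1 := by
      intro j
      by_cases hj : j ∈ S
      · rw [hc1 j hj]; exact fuchs_abs_sign _
      · exact (hc2 j hj).le
    have e0 : ∑ j, |x0 j| = ∑ j, (Aᵀ j ⬝ᵥ c) * x0 j := by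
      refine Finset.sum_congr rfl fun j _ => ?_
      by_cases hj : j ∈ S
      · rw [hc1 j hj, fuchs_sign_mul]
      · simp [hx0 j hj]
    rw [e0, fuchs_dot, hy, ← hx, ← fuchs_dot]
    refine Finset.sum_lt_sum (fun j _ => ?_) ⟨k, Finset.mem_univ _, ?_⟩
    · calc _ ≤ |(Aᵀ j ⬝ᵥ c) * x j| := le_abs_self _
        _ = |Aᵀ j ⬝ᵥ c| * |x j| := abs_mul _ _
        _ ≤ _ := mul_le_of_le_one_left (abs_nonneg _) (hle j)
    · calc _ ≤ |(Aᵀ k ⬝ᵥ c) * x k| := le_abs_self _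
        _ = |Aᵀ k ⬝ᵥ c| * |x k| := abs_mul _ _
        _ < _ := mul_lt_of_lt_one_left (abs_pos.2 hxk) (hc2 k hk)
end

section
/- Suppose x0 ∈ ℝ^n is the unique minimizer of ‖x‖₁ over {x ∈ ℝ^n : A x = A x0}. If x' ∈ ℝ^n has the same support as x0 and sign(x'_i) = sign((x0)_i) for every index i in that support, then x' is the unique minimizer of ‖x‖₁ over {x ∈ ℝ^n : A x = A x'}. (Whether a vector is the unique ℓ1 minimizer of its own representation problem depends only on its support and the signs of its entries on that support.) -/
open Matrix

/-- **Discreteness of individual equivalence.** If `x0` is the unique minimizer of `‖x‖₁`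
over `{x : A x = A x0}`, and `x'` has the same support as `x0` with the same signs on that
support, then `x'` is the unique minimizer of `‖x‖₁` over `{x : A x = A x'}`. -/
theorem l1_unique_optimal_depends_only_on_support_and_signs {d n : ℕ}
    (A : Matrix (Fin d) (Fin n) ℝ) (x0 x' : Fin n → ℝ)
    (hunique : ∀ x : Fin n → ℝ, A.mulVec x = A.mulVec x0 → x ≠ x0 →
      ∑ i, |x0 i| < ∑ i, |x i|)
    (hsupp : ∀ i, x' i ≠ 0 ↔ x0 i ≠ 0)
    (hsign : ∀ i, x0 i ≠ 0 → Real.sign (x' i) = Real.sign (x0 i)) :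
    ∀ x : Fin n → ℝ, A.mulVec x = A.mulVec x' → x ≠ x' →
      ∑ i, |x' i| < ∑ i, |x i| := by
  intro x hx hne
  have hev : ∀ᶠ t : ℝ in nhdsWithin 0 (Set.Ioi 0),
      ∀ i, x0 i ≠ 0 → t * |x i - x' i| < |x0 i| := by
    rw [Filter.eventually_all]
    intro i
    by_cases h0 : x0 i = 0
    · exact Filter.Eventually.of_forall (fun t h => absurd h0 h)
    · have hc : Filter.Tendsto (fun t : ℝ => t * |x i - x' i|) (nhds 0) (nhds 0) := by
        have : Continuous (fun t : ℝ => t * |x i - x' i|) := by fun_prop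
        simpa using this.tendsto 0
      have h1 := (hc.eventually (gt_mem_nhds (abs_pos.mpr h0))).filter_mono
        (nhdsWithin_le_nhds (s := Set.Ioi (0:ℝ)))
      exact h1.mono (fun t ht _ => ht)
  obtain ⟨t, ht, htpos⟩ := (hev.and self_mem_nhdsWithin).exists
  have htpos : 0 < t := htpos
  have hlt := hunique (x0 + t • (x - x'))
    (by rw [mulVec_add, mulVec_smul, mulVec_sub, hx]; simp)
    (by
      intro h
      have h2 : t • (x - x') = 0 := by simpa using h
      rcases smul_eq_zero.mp h2 with h3 | h3
      · exact htpos.ne' h3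
      · exact hne (sub_eq_zero.mp h3))
  have key : ∀ i, |(x0 + t • (x - x')) i| - |x0 i| ≤ t * (|x i| - |x' i|) := by
    intro i
    simp only [Pi.add_apply, Pi.smul_apply, Pi.sub_apply, smul_eq_mul]
    rcases lt_trichotomy (x0 i) 0 with h0 | h0 | h0
    · have hs := hsign i h0.ne
      rw [Real.sign_of_neg h0] at hs
      have hx' : x' i < 0 := by
        rcases lt_trichotomy (x' i) 0 with h | h | h
        · exact h
        · rw [h, Real.sign_zero] at hs; norm_num at hs
        · rw [Real.sign_of_pos h] at hs; norm_num at hs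
      have hb := ht i h0.ne
      rw [abs_of_neg h0] at hb
      have h4 := mul_le_mul_of_nonneg_left (le_abs_self (x i - x' i)) htpos.le
      have h5 := mul_le_mul_of_nonneg_left (neg_le_abs (x i)) htpos.le
      rw [abs_of_neg h0, abs_of_neg hx', abs_of_neg (by linarith)]
      linarith
    · have hx' : x' i = 0 := by
        by_contra h
        exact (hsupp i).mp h h0
      simp [h0, hx', abs_mul, abs_of_pos htpos]
    · have hs := hsign i h0.ne'
      rw [Real.sign_of_pos h0] at hs
      have hx' : 0 < x' i := by
        rcases lt_trichotomy (x' i) 0 with h | h | h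
        · rw [Real.sign_of_neg h] at hs; norm_num at hs
        · rw [h, Real.sign_zero] at hs; norm_num at hs
        · exact h
      have hb := ht i h0.ne'
      rw [abs_of_pos h0] at hb
      have h4 := mul_le_mul_of_nonneg_left (neg_le_abs (x i - x' i)) htpos.le
      have h5 := mul_le_mul_of_nonneg_left (le_abs_self (x i)) htpos.le
      rw [abs_of_pos h0, abs_of_pos hx', abs_of_pos (by linarith)]
      linarith
  have hsum := Finset.sum_le_sum (fun i (_ : i ∈ Finset.univ) => key i)
  rw [← Finset.mul_sum, Finset.sum_sub_distrib, Finset.sum_sub_distrib] at hsum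
  have hpos : 0 < t * (∑ i, |x i| - ∑ i, |x' i|) := by linarith
  have := (mul_pos_iff_of_pos_left htpos).mp hpos
  linarith
end

section
/- Let x̃0 ∈ ℝ^{2n} satisfy x̃0 ≥ 0 and Ã x̃0 = y, with support S of size m ≤ d, and suppose the columns {ã_j : j ∈ S} of Ã are linearly independent. Let P* = {c ∈ ℝ^d : ã_jᵀ c ≤ 1 for all j = 1,…,2n} and F* = {c ∈ P* : ã_jᵀ c = 1 for all j ∈ S}. Then x̃0 is the unique minimizer of 1ᵀx̃ over {x̃ ≥ 0 : Ã x̃ = y} if and only if the affine span of F* has dimension d − m and for every j ∉ S there exists c ∈ F* with ã_jᵀ c < 1 (i.e., F* is a nondegenerate (d−m)-dimensional face of the polar polytope P* whose equality set is exactly S). -/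
open Matrix

lemma aux_eps {ι : Type*} (T : Finset ι) (p q : ι → ℝ) (h : ∀ j ∈ T, 0 < p j) :
    ∃ ε : ℝ, 0 < ε ∧ ∀ j ∈ T, 0 < p j + ε * q j := by
  have h1 : ∀ᶠ ε in nhdsWithin (0:ℝ) (Set.Ioi 0), ∀ j ∈ T, 0 < p j + ε * q j := by
    rw [Filter.eventually_all_finset]
    intro j hj
    have hc : Continuous fun ε : ℝ => p j + ε * q j := by fun_prop
    have := hc.tendsto 0
    apply Filter.Eventually.filter_mono nhdsWithin_le_nhds
    apply this.eventually
    apply eventually_gt_nhds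
    simpa using h j hj
  obtain ⟨ε, h2, h3⟩ := (h1.and self_mem_nhdsWithin).exists
  exact ⟨ε, h3, h2⟩

/-- The lifting map. -/
noncomputable def auxL {ι : Type*} [Fintype ι] {d : ℕ} (a : ι → Fin d → ℝ) :
    (ι → ℝ) →ₗ[ℝ] (Fin d → ℝ) × ℝ :=
  LinearMap.prod (∑ j, (LinearMap.proj j : (ι → ℝ) →ₗ[ℝ] ℝ).smulRight (a j))
    (∑ j, (LinearMap.proj j : (ι → ℝ) →ₗ[ℝ] ℝ))

lemma auxL_apply {ι : Type*} [Fintype ι] {d : ℕ} (a : ι → Fin d → ℝ) (x : ι → ℝ) :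
    auxL a x = (∑ j, x j • a j, ∑ j, x j) := by
  simp [auxL]

lemma aux_sep {ι : Type*} [Fintype ι] [DecidableEq ι] {d : ℕ} (a : ι → Fin d → ℝ) (S : Finset ι)
    (h : ∀ z : ι → ℝ, (∀ j ∉ S, 0 ≤ z j) → ∑ j, z j • a j = 0 → ∑ j, z j = 0 →
      ∀ j ∉ S, z j = 0) :
    ∃ (c : Fin d → ℝ) (t : ℝ), (∀ j ∈ S, a j ⬝ᵥ c = t) ∧ ∀ j ∉ S, a j ⬝ᵥ c < t := by
  let K : Set (ι → ℝ) := stdSimplex ℝ ι ∩ {x | ∀ j ∈ S, x j = 0}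
  let W : Submodule ℝ (ι → ℝ) :=
    { carrier := {x | ∀ j ∉ S, x j = 0}
      add_mem' := by
        intro x y hx hy j hj
        simp [hx j hj, hy j hj]
      zero_mem' := by intro j hj; rfl
      smul_mem' := by
        intro r x hx j hj
        simp [hx j hj] }
  have hKc : IsCompact K := by
    apply (isCompact_stdSimplex ℝ ι).inter_right
    have : {x : ι → ℝ | ∀ j ∈ S, x j = 0} = ⋂ j ∈ S, {x | x j = 0} := by ext; simp
    rw [this]
    exact isClosed_biInter fun j _ => isClosed_eq (continuous_apply j) continuous_const
  have hKv : Convex ℝ K := by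
    apply (convex_stdSimplex ℝ ι).inter
    intro x hx y hy s t _ _ _ j hj
    simp [hx j hj, hy j hj]
  have hdis : Disjoint (auxL a '' K) (W.map (auxL a) : Set ((Fin d → ℝ) × ℝ)) := by
    rw [Set.disjoint_left]
    rintro _ ⟨k, hk, rfl⟩ ⟨w, hw, hwk⟩
    have h0 : auxL a (k - w) = 0 := by rw [map_sub, hwk, sub_self]
    rw [auxL_apply, Prod.mk_eq_zero] at h0
    have h2 := h (k - w) (fun j hj => by simpa [hw j hj] using hk.1.1 j) h0.1 h0.2
    have h3 : ∀ j, k j = 0 := by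
      intro j
      by_cases hj : j ∈ S
      · exact hk.2 j hj
      · simpa [hw j hj] using h2 j hj
    have := hk.1.2
    simp [h3] at this
  obtain ⟨f, u, v, h1, h2, h3⟩ := geometric_hahn_banach_compact_closed
    (hKv.linear_image (auxL a)) (hKc.image (auxL a).continuous_of_finiteDimensional)
    (W.map (auxL a)).convex (Submodule.closed_of_finiteDimensional _) hdis
  have hv : v < 0 := by simpa using h3 0 (Submodule.zero_mem _)
  have hW : ∀ w ∈ W.map (auxL a), f w = 0 := by
    intro w hw
    by_contra hne
    have := h3 (((v - 1) / f w) • w) (Submodule.smul_mem _ _ hw)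
    rw [map_smul, smul_eq_mul, div_mul_cancel₀ _ hne] at this
    linarith
  have hsing : ∀ j, auxL a (Pi.single j 1) = (a j, 1) := by
    intro j
    rw [auxL_apply]
    simp [Pi.single_apply]
  have hf : ∀ x : Fin d → ℝ, f (x, 1) = x ⬝ᵥ (fun i => f (Pi.single i 1, 0)) + f (0, 1) := by
    intro x
    have : (x, (1:ℝ)) = ∑ i, x i • ((Pi.single i 1, 0) : (Fin d → ℝ) × ℝ) + (0, 1) := by
      ext i
      · simp [Prod.fst_sum, Finset.sum_apply, Pi.single_apply]
      · simp [Prod.snd_sum]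
    rw [this, map_add, map_sum]
    simp only [map_smul, smul_eq_mul, dotProduct]
  refine ⟨fun i => f (Pi.single i 1, 0), - f (0, 1), ?_, ?_⟩
  · intro j hj
    have h5 := hW (auxL a (Pi.single j 1)) ⟨_, ?_, rfl⟩
    · rw [hsing, hf] at h5
      linarith
    · intro i hi
      exact Pi.single_eq_of_ne (by rintro rfl; exact hi hj) _
  · intro j hj
    have h5 := h1 (auxL a (Pi.single j 1)) ⟨_, ⟨single_mem_stdSimplex ℝ j, ?_⟩, rfl⟩
    · rw [hsing, hf] at h5
      linarith
    · intro i hi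
      exact Pi.single_eq_of_ne (by rintro rfl; exact hj hi) _

lemma aux_dim {ι : Type*} [Fintype ι] [DecidableEq ι] {d : ℕ} (a : ι → Fin d → ℝ) (S : Finset ι)
    (hrank : LinearIndependent ℝ (fun j : S => a j.val)) (c : Fin d → ℝ)
    (h1 : ∀ j ∈ S, a j ⬝ᵥ c = 1) (h2 : ∀ j ∉ S, a j ⬝ᵥ c < 1) :
    Module.finrank ℝ (affineSpan ℝ {c : Fin d → ℝ | (∀ j, a j ⬝ᵥ c ≤ 1) ∧
      (∀ j ∈ S, a j ⬝ᵥ c = 1)}).direction = d - S.card := by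
  let M : Matrix S (Fin d) ℝ := Matrix.of fun j : S => a j.val
  have hM : M.rank = S.card := by
    have : LinearIndependent ℝ M.row := hrank
    simpa using this.rank_matrix
  have hK : Module.finrank ℝ (LinearMap.ker M.mulVecLin) = d - S.card := by
    have := LinearMap.finrank_range_add_finrank_ker M.mulVecLin
    rw [← hM]
    simp at this
    unfold Matrix.rank
    omega
  rw [← hK]
  have hmem : ∀ v, v ∈ LinearMap.ker M.mulVecLin ↔ ∀ j ∈ S, a j ⬝ᵥ v = 0 := by
    intro v
    rw [LinearMap.mem_ker, Matrix.mulVecLin_apply, funext_iff]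
    simp [M, Matrix.mulVec]
  have hcF : c ∈ {c : Fin d → ℝ | (∀ j, a j ⬝ᵥ c ≤ 1) ∧ (∀ j ∈ S, a j ⬝ᵥ c = 1)} := by
    refine ⟨fun j => ?_, h1⟩
    by_cases hj : j ∈ S
    · exact (h1 j hj).le
    · exact (h2 j hj).le
  suffices hd : (affineSpan ℝ {c : Fin d → ℝ | (∀ j, a j ⬝ᵥ c ≤ 1) ∧
      (∀ j ∈ S, a j ⬝ᵥ c = 1)}).direction = LinearMap.ker M.mulVecLin by rw [hd]
  rw [direction_affineSpan]
  apply le_antisymm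
  · rw [vectorSpan_def, Submodule.span_le]
    rintro _ ⟨x, hx, y, hy, rfl⟩
    rw [SetLike.mem_coe, hmem]
    intro j hj
    simp [dotProduct_sub, hx.2 j hj, hy.2 j hj]
  · intro v hv
    rw [hmem] at hv
    obtain ⟨ε, hε, h⟩ := aux_eps (Finset.univ \ S) (fun j => 1 - a j ⬝ᵥ c) (fun j => - (a j ⬝ᵥ v))
      (by intro j hj; simp at hj; have := h2 j hj; linarith)
    have h3 : c + ε • v ∈ {c : Fin d → ℝ | (∀ j, a j ⬝ᵥ c ≤ 1) ∧ (∀ j ∈ S, a j ⬝ᵥ c = 1)} := by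
      constructor
      · intro j
        rw [dotProduct_add, dotProduct_smul, smul_eq_mul]
        by_cases hj : j ∈ S
        · simp [hv j hj, h1 j hj]
        · have := h j (by simp [hj])
          linarith
      · intro j hj
        simp [hv j hj, h1 j hj]
    have h4 := vsub_mem_vectorSpan ℝ h3 hcF
    simp only [vsub_eq_sub, add_sub_cancel_left] at h4
    exact (Submodule.smul_mem_iff _ hε.ne').1 h4

/-- **Geometry of the Fuchs condition on the polar polytope.** Let `x̃0 ≥ 0` solve
`Ã x̃0 = y` with support `S` of size `m ≤ d`, with the columns of `Ã` indexed by `S` linearly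
independent. Let `P* = {c : ã_jᵀ c ≤ 1 ∀ j}` and `F* = {c ∈ P* : ã_jᵀ c = 1 ∀ j ∈ S}`. Then
`x̃0` is the unique minimizer of `1ᵀ x̃` over `{x̃ ≥ 0 : Ã x̃ = y}` if and only if the affine
span of `F*` has dimension `d − m` and for every `j ∉ S` there is `c ∈ F*` with
`ã_jᵀ c < 1` (i.e. `F*` is a nondegenerate `(d−m)`-face of `P*` with equality set `S`). -/
theorem fuchs_iff_dual_face {d n : ℕ} (A : Matrix (Fin d) (Fin n) ℝ) (y : Fin d → ℝ)
    (xt0 : Fin n ⊕ Fin n → ℝ) (S : Finset (Fin n ⊕ Fin n)) (m : ℕ)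
    (hpos : ∀ j, 0 ≤ xt0 j)
    (hy : (doubled A).mulVec xt0 = y)
    (hS : ∀ j, j ∈ S ↔ xt0 j ≠ 0) (hcard : S.card = m) (hmd : m ≤ d)
    (hrank : LinearIndependent ℝ (fun j : S => (doubled A).transpose j.val)) :
    (∀ xt : Fin n ⊕ Fin n → ℝ, (∀ j, 0 ≤ xt j) → (doubled A).mulVec xt = y → xt ≠ xt0 →
        ∑ j, xt0 j < ∑ j, xt j) ↔
      (Module.finrank ℝ
          (affineSpan ℝ {c : Fin d → ℝ |
            (∀ j, (doubled A).transpose j ⬝ᵥ c ≤ 1) ∧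
            (∀ j ∈ S, (doubled A).transpose j ⬝ᵥ c = 1)}).direction = d - m ∧
        ∀ j ∉ S, ∃ c : Fin d → ℝ,
          ((∀ j', (doubled A).transpose j' ⬝ᵥ c ≤ 1) ∧
            (∀ j' ∈ S, (doubled A).transpose j' ⬝ᵥ c = 1)) ∧
          (doubled A).transpose j ⬝ᵥ c < 1) := by
  subst hcard
  have hmv : ∀ x, (doubled A).mulVec x = ∑ j, x j • (doubled A).transpose j := by
    intro x
    rw [Matrix.mulVec_eq_sum]
    simp
  have hneg : ∀ j : Fin n, (doubled A).transpose (Sum.inr j) = - (doubled A).transpose (Sum.inl j) := by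
    intro j
    ext i
    simp [doubled]
  rw [hmv] at hy
  simp only [hmv]
  generalize (doubled A).transpose = a at *
  have hind : ∀ z : Fin n ⊕ Fin n → ℝ, (∀ j ∉ S, z j = 0) → ∑ j, z j • a j = 0 → z = 0 := by
    intro z hz h0
    have h1 : ∑ j : S, z j.val • a j.val = 0 := by
      rw [Finset.sum_coe_sort S (fun j => z j • a j), ← h0]
      apply Finset.sum_subset (Finset.subset_univ _)
      intro j _ hj
      simp [hz j hj]
    have h2 := Fintype.linearIndependent_iff.1 hrank (fun j => z j.val) h1
    ext j
    by_cases hj : j ∈ S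
    · exact h2 ⟨j, hj⟩
    · exact hz j hj
  constructor
  · intro huniq
    have hex : ∃ c : Fin d → ℝ, (∀ j ∈ S, a j ⬝ᵥ c = 1) ∧ ∀ j ∉ S, a j ⬝ᵥ c < 1 := by
      obtain ⟨c, t, hc1, hc2⟩ := aux_sep a S (by
        intro z hz h0 hs j hj
        by_contra hne
        obtain ⟨ε, hε, h⟩ := aux_eps S xt0 z
          (fun j hj => lt_of_le_of_ne (hpos j) (Ne.symm ((hS j).1 hj)))
        have := huniq (xt0 + ε • z) ?_ ?_ ?_
        · simp [Finset.sum_add_distrib, ← Finset.mul_sum, hs] at this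
        · intro i
          by_cases hi : i ∈ S
          · exact (h i hi).le
          · exact add_nonneg (hpos i) (mul_nonneg hε.le (hz i hi))
        · simp [add_smul, Finset.sum_add_distrib, mul_smul, ← Finset.smul_sum, h0, hy]
        · intro heq
          have := congrFun heq j
          simp [hε.ne', hne] at this)
      rcases Nat.eq_zero_or_pos n with rfl | hn
      · exact ⟨0, fun j => by rcases j with j | j <;> exact j.elim0,
          fun j => by rcases j with j | j <;> exact j.elim0⟩
      · have hle : ∀ j, a j ⬝ᵥ c ≤ t := fun j => by
          by_cases hj : j ∈ S
          · exact (hc1 j hj).le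
          · exact (hc2 j hj).le
        let k : Fin n := ⟨0, hn⟩
        have hk : a (Sum.inr k) ⬝ᵥ c = - (a (Sum.inl k) ⬝ᵥ c) := by
          rw [hneg, neg_dotProduct]
        have ht : 0 < t := by
          by_cases hl : Sum.inl k ∈ S
          · by_cases hr : Sum.inr k ∈ S
            · exfalso
              have := hind (Pi.single (Sum.inl k) 1 + Pi.single (Sum.inr k) 1) (by
                intro j hj
                have h1 : j ≠ Sum.inl k := by rintro rfl; exact hj hl
                have h2 : j ≠ Sum.inr k := by rintro rfl; exact hj hr
                simp [h1, h2]) (by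
                simp [add_smul, Finset.sum_add_distrib, Pi.single_apply, hneg])
              have := congrFun this (Sum.inl k)
              simp at this
            · have := hc2 _ hr
              have := hle (Sum.inl k)
              linarith
          · have := hc2 _ hl
            have := hle (Sum.inr k)
            linarith
        refine ⟨t⁻¹ • c, fun j hj => ?_, fun j hj => ?_⟩
        · rw [dotProduct_smul, hc1 j hj, smul_eq_mul, inv_mul_cancel₀ ht.ne']
        · rw [dotProduct_smul, smul_eq_mul, inv_mul_lt_iff₀ ht, mul_one]
          exact hc2 j hj
    obtain ⟨c, hc1, hc2⟩ := hex
    refine ⟨aux_dim a S hrank c hc1 hc2, fun j hj => ⟨c, ⟨fun i => ?_, hc1⟩, hc2 j hj⟩⟩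
    by_cases hi : i ∈ S
    · exact (hc1 i hi).le
    · exact (hc2 i hi).le
  · rintro ⟨-, h⟩ x hx hxy hne
    have hj : ∃ j ∉ S, x j ≠ 0 := by
      by_contra! hcon
      apply hne
      rw [← sub_eq_zero]
      apply hind
      · intro j hj
        have : xt0 j = 0 := by
          by_contra h'
          exact hj ((hS j).2 h')
        simp [this, hcon j hj]
      · simp [sub_smul, hxy, hy]
    obtain ⟨j, hjS, hj0⟩ := hj
    obtain ⟨c, ⟨hc1, hc2⟩, hc3⟩ := h j hjS
    have e : ∀ z : Fin n ⊕ Fin n → ℝ, (∑ j, z j • a j) ⬝ᵥ c = ∑ j, z j * (a j ⬝ᵥ c) := by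
      intro z
      rw [sum_dotProduct]
      simp
    calc ∑ j, xt0 j = ∑ j, xt0 j * (a j ⬝ᵥ c) := by
          apply Finset.sum_congr rfl
          intro i _
          by_cases hi : i ∈ S
          · rw [hc2 i hi, mul_one]
          · have : xt0 i = 0 := by
              by_contra h'
              exact hi ((hS i).2 h')
            simp [this]
      _ = ∑ j, x j * (a j ⬝ᵥ c) := by rw [← e, ← e, hy, hxy]
      _ < ∑ j, x j := by
          apply Finset.sum_lt_sum
          · intro i _
            exact mul_le_of_le_one_right (hx i) (hc1 i)
          · exact ⟨j, Finset.mem_univ _,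
              mul_lt_of_lt_one_right (lt_of_le_of_ne (hx j) (Ne.symm hj0)) hc3⟩
end

section
/- Let A_opt be a d×m submatrix of columns of A with linearly independent columns, with A_opt† = (A_optᵀ A_opt)⁻¹ A_optᵀ, and suppose the Exact Recovery Condition fails: there is a column a_{j0} of A not among the columns of A_opt with ‖A_opt† a_{j0}‖₁ ≥ 1. Then there exists a sign vector σ ∈ {−1,+1}^m such that the signal y = (A_opt†)ᵀ σ lies in the column span of A_opt, satisfies a_iᵀ y = σ_i (so |a_iᵀ y| = 1) for every column a_i of A_opt, and satisfies |a_{j0}ᵀ y| ≥ 1; hence an atom outside A_opt achieves at least the maximal correlation with y among all atoms of A_opt, so Orthogonal Matching Pursuit may select a wrong atom at its first step and cannot be guaranteed to recover the representation in m steps. -/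
open Matrix

/-- **Failure of ERC defeats OMP in `m` steps (Tropp, converse direction).** If the columns
of `A` indexed by `S` are linearly independent and `‖A_opt† a_{j0}‖₁ ≥ 1` for some
`j0 ∉ S`, then there is a sign vector `σ ∈ {±1}^S` such that the signal
`y = (A_opt†)ᵀ σ` lies in the column span of `A_opt`, satisfies `a_iᵀ y = σ_i` for every
`i ∈ S`, and satisfies `|a_{j0}ᵀ y| ≥ 1`; so an atom outside `A_opt` achieves at least the
maximal correlation with `y` among the atoms of `A_opt`. -/
theorem erc_failure_omp {d n : ℕ} (A : Matrix (Fin d) (Fin n) ℝ) (S : Finset (Fin n))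
    (hrank : LinearIndependent ℝ (fun j : S => A.transpose j.val))
    (j0 : Fin n) (hj0 : j0 ∉ S)
    (herc_fails : 1 ≤ ∑ i : S, |(pinvCols A S).mulVec (A.transpose j0) i|) :
    ∃ σ : S → ℝ, (∀ i, σ i = 1 ∨ σ i = -1) ∧
      (pinvCols A S).transpose.mulVec σ ∈
        Submodule.span ℝ (Set.range fun j : S => A.transpose j.val) ∧
      (∀ i : S, A.transpose i.val ⬝ᵥ (pinvCols A S).transpose.mulVec σ = σ i) ∧
      1 ≤ |A.transpose j0 ⬝ᵥ (pinvCols A S).transpose.mulVec σ| := by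
  have hinj : Function.Injective (subCols A S).mulVec := by
    rw [Matrix.mulVec_injective_iff]
    exact hrank
  have hpd : ((subCols A S).transpose * subCols A S).PosDef := by
    have := Matrix.PosDef.conjTranspose_mul_self (subCols A S) hinj
    rwa [Matrix.conjTranspose_eq_transpose_of_trivial] at this
  have hu : IsUnit ((subCols A S).transpose * subCols A S).det :=
    (Matrix.isUnit_iff_isUnit_det _).1 hpd.isUnit
  have hleft : pinvCols A S * subCols A S = 1 := by
    unfold pinvCols
    rw [Matrix.mul_assoc, Matrix.nonsing_inv_mul _ hu]
  have hdot : ∀ (v : Fin d → ℝ) (σ : S → ℝ),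
      v ⬝ᵥ (pinvCols A S).transpose.mulVec σ = (pinvCols A S).mulVec v ⬝ᵥ σ := by
    intro v σ
    rw [Matrix.dotProduct_mulVec, Matrix.vecMul_transpose]
  refine ⟨fun i => if 0 ≤ (pinvCols A S).mulVec (A.transpose j0) i then 1 else -1,
    ?_, ?_, ?_, ?_⟩
  · intro i
    dsimp only
    split_ifs
    · exact Or.inl rfl
    · exact Or.inr rfl
  · generalize (fun i : S => if 0 ≤ (pinvCols A S).mulVec (A.transpose j0) i
      then (1 : ℝ) else -1) = σ
    have h : (pinvCols A S).transpose.mulVec σ = (subCols A S).mulVec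
        ((((subCols A S).transpose * subCols A S)⁻¹).transpose.mulVec σ) := by
      unfold pinvCols
      rw [Matrix.transpose_mul, Matrix.transpose_transpose, Matrix.mulVec_mulVec]
    rw [h]
    have h2 := Matrix.range_mulVecLin (subCols A S)
    have h3 : (subCols A S).mulVec
        ((((subCols A S).transpose * subCols A S)⁻¹).transpose.mulVec σ) ∈
        LinearMap.range (subCols A S).mulVecLin := ⟨_, rfl⟩
    rw [h2] at h3
    exact h3
  · intro i
    rw [hdot]
    have h : (pinvCols A S).mulVec (A.transpose i.val) = Pi.single i 1 := by
      have h1 : A.transpose i.val = (subCols A S).mulVec (Pi.single i 1) := by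
        rw [Matrix.mulVec_single_one]
        rfl
      rw [h1, Matrix.mulVec_mulVec, hleft, Matrix.one_mulVec]
    rw [h, single_one_dotProduct]
  · rw [hdot]
    refine le_trans herc_fails (le_trans (le_of_eq ?_) (le_abs_self _))
    unfold dotProduct
    refine Finset.sum_congr rfl fun i _ => ?_
    beta_reduce
    split_ifs with hi
    · rw [abs_of_nonneg hi, mul_one]
    · rw [abs_of_neg (not_le.1 hi), mul_neg_one]
end

section
/- Let A be a real d×n matrix with d > 2 and n ≥ d + 2, and suppose that for every y ∈ ℝ^d, every solution x0 of A x0 = y with at most k nonzero entries is the unique minimizer of ‖x‖₁ over {x ∈ ℝ^n : A x = y} (equivalently, P = conv{±a_1,…,±a_n} is k-neighbourly). Then k ≤ ⌊(d+1)/3⌋. -/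
open Matrix

lemma nb_topk {m : ℕ} (k : ℕ) (a l : Fin m → ℝ) (ha : ∀ i, 0 ≤ a i) (h0 : ∀ i, 0 ≤ l i)
    (h1 : ∀ i, l i ≤ 1) (hs : ∑ i, l i ≤ k) :
    ∃ S : Finset (Fin m), S.card ≤ k ∧ ∑ i, l i * a i ≤ ∑ i ∈ S, a i := by
  by_cases hk : m ≤ k
  · refine ⟨Finset.univ, by simpa using hk, Finset.sum_le_sum fun i _ => ?_⟩
    nlinarith [ha i, h1 i]
  push Not at hk
  obtain ⟨S, hS, hmax⟩ := Finset.exists_max_image (Finset.powersetCard k (Finset.univ : Finset (Fin m)))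
    (fun S => ∑ i ∈ S, a i) (by
      rw [Finset.powersetCard_nonempty]; simpa using hk.le)
  have hc : S.card = k := (Finset.mem_powersetCard.1 hS).2
  refine ⟨S, hc.le, ?_⟩
  have hex : ∀ i ∈ S, ∀ j ∉ S, a j ≤ a i := by
    intro i hi j hj
    have hj' : j ∉ S.erase i := fun h => hj (Finset.mem_of_mem_erase h)
    have := hmax (insert j (S.erase i)) (by
      rw [Finset.mem_powersetCard]
      refine ⟨Finset.subset_univ _, ?_⟩
      rw [Finset.card_insert_of_notMem hj', Finset.card_erase_of_mem hi, hc]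
      have : 0 < S.card := Finset.card_pos.2 ⟨i, hi⟩
      omega)
    rw [Finset.sum_insert hj'] at this
    have h2 := Finset.add_sum_erase S a hi
    linarith
  obtain ⟨t, ht0, ht1, ht2⟩ : ∃ t : ℝ, 0 ≤ t ∧ (∀ i ∈ S, t ≤ a i) ∧ ((S.Nonempty → ∀ j ∉ S, a j ≤ t)) := by
    by_cases hne : S.Nonempty
    · obtain ⟨i, hi, him⟩ := Finset.exists_min_image S a hne
      exact ⟨a i, ha i, him, fun _ j hj => hex i hi j hj⟩
    · refine ⟨0, le_rfl, fun i _ => ha i, fun h => absurd h hne⟩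
  by_cases hne : S.Nonempty
  · have key : ∑ i, (l i - (if i ∈ S then 1 else 0)) * (a i - t) ≤ 0 := by
      apply Finset.sum_nonpos
      intro i _
      split_ifs with h
      · nlinarith [h1 i, ht1 i h]
      · nlinarith [h0 i, ht2 hne i h]
    have e : ∑ i, (l i - (if i ∈ S then 1 else 0)) * (a i - t)
        = ∑ i, l i * a i - ∑ i ∈ S, a i - t * (∑ i, l i - k) := by
      have e1 : ∑ i ∈ S, a i = ∑ i, (if i ∈ S then (1:ℝ) else 0) * a i := by simp
      have e2 : (k : ℝ) = ∑ i : Fin m, (if i ∈ S then (1:ℝ) else 0) := by simp [hc]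
      rw [e1, e2, ← Finset.sum_sub_distrib, ← Finset.sum_sub_distrib, Finset.mul_sum, ← Finset.sum_sub_distrib]
      exact Finset.sum_congr rfl fun i _ => by ring
    nlinarith
  · have hS0 : S = ∅ := Finset.not_nonempty_iff_eq_empty.1 hne
    have hk0 : k = 0 := by rw [← hc, hS0]; rfl
    have hl : ∀ i, l i = 0 := by
      have := (Finset.sum_eq_zero_iff_of_nonneg (fun i _ => h0 i) (s := Finset.univ)).1
        (le_antisymm (by simpa [hk0] using hs) (Finset.sum_nonneg fun i _ => h0 i))
      simpa using this
    simp [hl, hS0]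

lemma nb_nsp {d n m : ℕ} (A : Matrix (Fin d) (Fin n) ℝ) (k : ℕ) (e : Fin m → Fin n)
    (he : Function.Injective e)
    (hrec : ∀ (y : Fin d → ℝ) (x0 : Fin n → ℝ), A.mulVec x0 = y →
      (Finset.univ.filter fun i => x0 i ≠ 0).card ≤ k →
      ∀ x : Fin n → ℝ, A.mulVec x = y → x ≠ x0 → ∑ i, |x0 i| < ∑ i, |x i|)
    (h : Fin m → ℝ) (hh : ∀ r, ∑ i, A r (e i) * h i = 0) (hne : h ≠ 0)
    (S : Finset (Fin m)) (hS : S.card ≤ k) : 2 * ∑ i ∈ S, |h i| < ∑ i, |h i| := by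
  have hsum : ∀ (f : Fin n → ℝ) (u : Fin m → ℝ), 
      ∑ j, f j * Function.extend e u 0 j = ∑ i, f (e i) * u i := by
    intro f u
    symm
    apply Fintype.sum_of_injective e he
    · intro j hj
      rw [Function.extend_apply' _ _ _ (by simpa using hj)]; simp
    · intro i; rw [he.extend_apply]
  have habs : ∀ (u : Fin m → ℝ), ∑ j, |Function.extend e u 0 j| = ∑ i, |u i| := by
    intro u
    symm
    apply Fintype.sum_of_injective e he
    · intro j hj
      rw [Function.extend_apply' _ _ _ (by simpa using hj)]; simp
    · intro i; rw [he.extend_apply]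
  set u : Fin m → ℝ := fun i => if i ∈ S then h i else 0 with hu
  set w : Fin m → ℝ := fun i => if i ∈ S then 0 else - h i with hw
  have := hrec (A.mulVec (Function.extend e u 0)) (Function.extend e u 0) rfl (by
    refine le_trans ?_ hS
    rw [← Finset.card_image_of_injective S he]
    apply Finset.card_le_card
    intro j hj
    simp only [Finset.mem_filter, Finset.mem_univ, true_and] at hj
    by_cases hj' : ∃ i, e i = j
    · obtain ⟨i, rfl⟩ := hj'
      rw [he.extend_apply] at hj
      refine Finset.mem_image_of_mem _ ?_
      by_contra hc
      exact hj (by simp [hu, hc])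
    · rw [Function.extend_apply' _ _ _ hj'] at hj
      simp at hj) (Function.extend e w 0) (by
    funext r
    simp only [Matrix.mulVec, dotProduct]
    rw [hsum, hsum, ← sub_eq_zero, ← Finset.sum_sub_distrib, ← neg_eq_zero, ← Finset.sum_neg_distrib, ← hh r]
    refine Finset.sum_congr rfl fun i _ => ?_
    by_cases hi : i ∈ S <;> simp [hu, hw, hi]) (by
    intro hc
    apply hne
    funext i
    have := congrFun hc (e i)
    rw [he.extend_apply, he.extend_apply] at this
    by_cases hi : i ∈ S <;> simp [hu, hw, hi] at this
    · simpa using this.symm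
    · simpa using this)
  rw [habs, habs] at this
  have e1 : ∑ i, |u i| = ∑ i ∈ S, |h i| := by
    simp [hu, apply_ite abs]
  have e2 : ∑ i, |h i| = ∑ i, |u i| + ∑ i, |w i| := by
    rw [← Finset.sum_add_distrib]
    refine Finset.sum_congr rfl fun i _ => ?_
    by_cases hi : i ∈ S <;> simp [hu, hw, hi]
  rw [e2]; linarith

lemma nb_four (p q r : ℝ) (hp : |p| ≤ 1) (hq : |q| ≤ 1) (hr : |r| ≤ 1) (hs : |q - p - r| ≤ 1) :
    |q - p| + |q - r| + |p + r| ≤ 2 := by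
  rw [abs_le] at *
  rcases abs_cases (q - p) with h | h <;> rcases abs_cases (q - r) with h' | h' <;>
    rcases abs_cases (p + r) with h'' | h'' <;> linarith

lemma nb_key : ∀ A B x y z w : ℝ, -1 < x → x < 0 → -1 ≤ y → y < 0 → 0 ≤ z → 0 ≤ w → z + w = 1 →
    A + B * x ≤ 0 → A * y + B ≤ 0 → 0 ≤ A * z + B * w → A = 0 ∧ B = 0 := by
  intro A B x y z w hx hx' hy hy' hz hw hzw h1 h2 h3
  have hA : A ≤ 0 := by
    by_contra hc
    push Not at hc
    have hB : 0 < B := by nlinarith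
    nlinarith
  have hB : B ≤ 0 := by nlinarith
  have hA' : A = 0 ∨ A < 0 := hA.eq_or_lt
  have hB' : B = 0 ∨ B < 0 := hB.eq_or_lt
  rcases hA' with rfl | hA' <;> rcases hB' with rfl | hB'
  · simp
  · exfalso; nlinarith
  · exfalso; nlinarith
  · exfalso
    have h4 : A * z ≤ 0 := by nlinarith
    have h5 : B * w ≤ 0 := by nlinarith
    have h6 : A * z = 0 := by linarith
    have h7 : B * w = 0 := by linarith
    rcases mul_eq_zero.1 h6 with h | h
    · linarith
    · rcases mul_eq_zero.1 h7 with h' | h' <;> linarith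

section
variable {E : Type*} [NormedAddCommGroup E] [NormedSpace ℝ E] {m : ℕ} (v : Fin m → E)

lemma nb_sumabs (hnorm : ∀ p : Fin m → ℝ, (∀ i, |p i| ≤ 1) → ‖∑ i, p i • v i‖ ≤ 1)
    (g : E →L[ℝ] ℝ) (hg : ‖g‖ ≤ 1) : ∑ i, |g (v i)| ≤ 1 := by
  have h := hnorm (fun i => if 0 ≤ g (v i) then 1 else -1) (fun i => by
    split_ifs <;> simp)
  have h2 := g.le_opNorm (∑ i, (if 0 ≤ g (v i) then (1:ℝ) else -1) • v i)
  have h3 : g (∑ i, (if 0 ≤ g (v i) then (1:ℝ) else -1) • v i) = ∑ i, |g (v i)| := by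
    rw [map_sum]
    refine Finset.sum_congr rfl fun i _ => ?_
    rw [map_smul]
    split_ifs with hc
    · simp [abs_of_nonneg hc]
    · simp [abs_of_neg (not_le.1 hc)]
  rw [h3] at h2
  have h4 := le_abs_self (∑ i, |g (v i)|)
  rw [Real.norm_eq_abs] at h2
  nlinarith [norm_nonneg g, norm_nonneg (∑ i, (if 0 ≤ g (v i) then (1:ℝ) else -1) • v i)]

lemma nb_norming (hnorm : ∀ p : Fin m → ℝ, (∀ i, |p i| ≤ 1) → ‖∑ i, p i • v i‖ ≤ 1)
    (g : E →L[ℝ] ℝ) (hg : ‖g‖ ≤ 1) (p : Fin m → ℝ) (hp : ∀ i, |p i| ≤ 1)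
    (hgp : g (∑ i, p i • v i) = 1) (i : Fin m) : p i * g (v i) = |g (v i)| := by
  have h1 := nb_sumabs v hnorm g hg
  have h2 : ∀ i ∈ Finset.univ, 0 ≤ |g (v i)| - p i * g (v i) := by
    intro i _
    have := le_abs_self (p i * g (v i))
    rw [abs_mul] at this
    nlinarith [hp i, abs_nonneg (g (v i))]
  have h3 : ∑ i, (|g (v i)| - p i * g (v i)) = 0 := by
    apply le_antisymm _ (Finset.sum_nonneg h2)
    rw [Finset.sum_sub_distrib]
    simp only [map_sum, map_smul, smul_eq_mul] at hgp
    linarith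
  have := (Finset.sum_eq_zero_iff_of_nonneg h2).1 h3 i (Finset.mem_univ _)
  linarith

/-- degenerate case -/
lemma nb_degen (hnorm : ∀ p : Fin m → ℝ, (∀ i, |p i| ≤ 1) → ‖∑ i, p i • v i‖ ≤ 1)
    (P Q R : E) (hQ : Q = P + R) (hspan : ∀ x : E, ∃ a b : ℝ, x = a • P + b • R)
    (p q r : Fin m → ℝ) (hp : ∀ i, |p i| ≤ 1) (hq : ∀ i, |q i| ≤ 1) (hr : ∀ i, |r i| ≤ 1)
    (hpP : ∑ i, p i • v i = P) (hqQ : ∑ i, q i • v i = Q) (hrR : ∑ i, r i • v i = R)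
    (g gR : E →L[ℝ] ℝ) (hg : ‖g‖ ≤ 1) (hgR : ‖gR‖ ≤ 1) (hgP : g P = 1) (hgQ : g Q = 1)
    (hRR : gR R = 1) :
    ∃ q' : Fin m → ℝ, (∀ i, |q' i| ≤ 1) ∧ ∑ i, q' i • v i = Q ∧ ∀ i, |q' i - p i - r i| ≤ 1 := by
  classical
  have hgR0 : g R = 0 := by
    have := hgQ
    rw [hQ, map_add, hgP] at this; linarith
  choose a b hab using fun i => hspan (v i)
  have hga : ∀ i, g (v i) = a i := fun i => by rw [hab i]; simp [hgP, hgR0]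
  have hpn := nb_norming v hnorm g hg p hp (by rw [hpP, hgP])
  have hqn := nb_norming v hnorm g hg q hq (by rw [hqQ, hgQ])
  have hrn := nb_norming v hnorm gR hgR r hr (by rw [hrR, hRR])
  have hT : ∀ i, a i ≠ 0 → q i = p i := fun i hi => by
    have h1 := hpn i
    have h2 := hqn i
    rw [hga] at h1 h2
    exact mul_right_cancel₀ hi (h2.trans h1.symm)
  have hT' : ∀ i, a i = 0 → v i = b i • R := fun i hi => by rw [hab i, hi]; simp
  have hrb : ∀ i, a i = 0 → r i * b i = |b i| := fun i hi => by
    have := hrn i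
    rw [hT' i hi] at this
    simpa [hRR] using this
  set D : (Fin m → ℝ) → ℝ := fun u => ∑ i, (if a i = 0 then (u i - p i) * b i else 0) with hD
  have hDsum : ∀ u : Fin m → ℝ, (∀ i, a i ≠ 0 → u i = p i) →
      ∑ i, u i • v i = P + D u • R := by
    intro u hu
    rw [← hpP, hD, Finset.sum_smul, ← Finset.sum_add_distrib]
    refine Finset.sum_congr rfl fun i _ => ?_
    split_ifs with h
    · rw [hT' i h]; module
    · rw [hu i h]; simp
  have hDq : D q = 1 := by
    have h1 := hDsum q hT
    rw [hqQ, hQ] at h1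
    have h2 := congrArg gR (add_left_cancel h1)
    rw [map_smul, hRR] at h2
    simpa using h2.symm
  have hDr : 1 ≤ D r := by
    rw [← hDq, hD]
    refine Finset.sum_le_sum fun i _ => ?_
    split_ifs with h
    · have h1 := hrb i h
      have h2 := le_abs_self (q i * b i)
      rw [abs_mul] at h2
      nlinarith [hq i, abs_nonneg (b i)]
    · rfl
  set θ : ℝ := (D r)⁻¹ with hθ
  have hθ0 : 0 ≤ θ := by positivity
  have hθ1 : θ ≤ 1 := inv_le_one_of_one_le₀ hDr
  have hconv : ∀ x y : ℝ, |x| ≤ 1 → |y| ≤ 1 → |(1 - θ) * x + θ * y| ≤ 1 := by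
    intro x y hx hy
    rw [abs_le] at *
    constructor <;> nlinarith
  refine ⟨fun i => if a i = 0 then p i + θ * (r i - p i) else p i, fun i => ?_, ?_, fun i => ?_⟩
  · dsimp only
    split_ifs
    · convert hconv (p i) (r i) (hp i) (hr i) using 2; ring
    · exact hp i
  · rw [hDsum _ (fun i hi => by simp [hi]), hQ]
    have : D (fun i => if a i = 0 then p i + θ * (r i - p i) else p i) = θ * D r := by
      rw [hD, Finset.mul_sum]
      refine Finset.sum_congr rfl fun i _ => ?_
      dsimp only
      split_ifs
      · ring
      · simp
    rw [this, hθ, inv_mul_cancel₀ (by linarith), one_smul]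
  · dsimp only
    split_ifs
    · rw [← abs_neg]
      convert hconv (r i) (p i) (hr i) (hp i) using 2; ring
    · simpa using hr i

lemma nb_hexagon (hE : Module.finrank ℝ E = 2) :
    ∃ P Q R : E, Q = P + R ∧ ‖P‖ = 1 ∧ ‖Q‖ = 1 ∧ ‖R‖ = 1 ∧
      (∀ x : E, ∃ a b : ℝ, x = a • P + b • R) := by
  have : FiniteDimensional ℝ E := FiniteDimensional.of_finrank_pos (by omega)
  have : Nontrivial E := Module.nontrivial_of_finrank_pos (R := ℝ) (by omega)
  obtain ⟨P, hP⟩ := exists_norm_eq E (zero_le_one)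
  have hrank : 1 < Module.rank ℝ E := by
    rw [← Module.finrank_eq_rank, hE]; norm_num
  have hc := isPreconnected_sphere hrank (0 : E) 1
  obtain ⟨Q, hQ, hQP⟩ : (1:ℝ) ∈ (fun X => ‖X - P‖) '' Metric.sphere (0 : E) 1 := by
    have := hc.intermediate_value (f := fun X => ‖X - P‖) (a := P) (b := -P) (by simpa using hP)
      (by simpa using hP) (by fun_prop)
    apply this
    have h2 : ‖-P - P‖ = 2 := by
      rw [show -P - P = (-2 : ℝ) • P by module, norm_smul, hP]; norm_num
    simp only [sub_self, norm_zero, h2]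
    constructor <;> norm_num
  have hQ1 : ‖Q‖ = 1 := by simpa using hQ
  refine ⟨P, Q, Q - P, by abel, hP, hQ1, hQP, ?_⟩
  have hli : LinearIndependent ℝ ![P, Q - P] := by
    rw [LinearIndependent.pair_iff' (by rintro rfl; simp at hP)]
    intro a ha
    simp only at hQP
    rw [← ha, norm_smul, hP, mul_one, Real.norm_eq_abs] at hQP
    have : Q = (1 + a) • P := by rw [add_smul, ha]; simp
    rw [this, norm_smul, hP, mul_one, Real.norm_eq_abs] at hQ1
    rcases abs_cases a with h | h <;> rcases abs_cases (1 + a) with h' | h' <;> linarith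
  have hsp := hli.span_eq_top_of_card_eq_finrank (by simp [hE])
  intro x
  have hx : x ∈ Submodule.span ℝ (Set.range ![P, Q - P]) := by rw [hsp]; trivial
  simp only [Matrix.range_cons, Matrix.range_empty, Set.union_empty, Set.singleton_union] at hx
  obtain ⟨a, b, h⟩ := Submodule.mem_span_pair.1 hx
  exact ⟨a, b, h.symm⟩

set_option maxHeartbeats 1000000 in
lemma nb_reps (hE : Module.finrank ℝ E = 2)
    (hnorm : ∀ p : Fin m → ℝ, (∀ i, |p i| ≤ 1) → ‖∑ i, p i • v i‖ ≤ 1)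
    (hrep : ∀ P : E, ‖P‖ = 1 → ∃ p : Fin m → ℝ, (∀ i, |p i| ≤ 1) ∧ ∑ i, p i • v i = P) :
    ∃ (P Q R : E) (p q r : Fin m → ℝ), Q = P + R ∧ ‖P‖ = 1 ∧ ‖Q‖ = 1 ∧ ‖R‖ = 1 ∧
      (∀ i, |p i| ≤ 1) ∧ (∀ i, |q i| ≤ 1) ∧ (∀ i, |r i| ≤ 1) ∧
      ∑ i, p i • v i = P ∧ ∑ i, q i • v i = Q ∧ ∑ i, r i • v i = R ∧
      ∀ i, |q i - p i - r i| ≤ 1 := by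
  classical
  obtain ⟨P, Q, R, hQ, hP1, hQ1, hR1, hspan⟩ := nb_hexagon (E := E) hE
  obtain ⟨p, hp, hpP⟩ := hrep P hP1
  obtain ⟨q, hq, hqQ⟩ := hrep Q hQ1
  obtain ⟨r, hr, hrR⟩ := hrep R hR1
  obtain ⟨gP, hgP, hPP⟩ := exists_dual_vector'' ℝ P
  obtain ⟨gQ, hgQ, hQQ⟩ := exists_dual_vector'' ℝ Q
  obtain ⟨gR, hgR, hRR⟩ := exists_dual_vector'' ℝ R
  rw [hP1] at hPP
  rw [hQ1] at hQQ
  rw [hR1] at hRR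
  norm_num at hPP hQQ hRR
  have bd : ∀ (g : E →L[ℝ] ℝ) (X : E), ‖g‖ ≤ 1 → ‖X‖ = 1 → |g X| ≤ 1 := by
    intro g X hg hX
    have := g.le_opNorm X
    rw [hX, mul_one, Real.norm_eq_abs] at this
    exact this.trans hg
  have hneg : ∀ (u : Fin m → ℝ), ∑ i, (-u i) • v i = -∑ i, u i • v i := by
    intro u; simp
  by_cases hx0 : gP R = 0
  · obtain ⟨q', h1, h2, h3⟩ := nb_degen v hnorm P Q R hQ hspan p q r hp hq hr hpP hqQ hrR gP gR
      hgP hgR hPP (by rw [hQ, map_add, hPP, hx0, add_zero]) hRR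
    exact ⟨P, Q, R, p, q', r, hQ, hP1, hQ1, hR1, hp, h1, hr, hpP, h2, hrR, h3⟩
  by_cases hy0 : gR P = 0
  · obtain ⟨q', h1, h2, h3⟩ := nb_degen v hnorm R Q P (by rw [hQ, add_comm])
      (fun x => by obtain ⟨a, b, h⟩ := hspan x; exact ⟨b, a, by rw [h, add_comm]⟩)
      r q p hr hq hp hrR hqQ hpP gR gP
      hgR hgP hRR (by rw [hQ, map_add, hRR, hy0, zero_add]) hPP
    exact ⟨P, Q, R, p, q', r, hQ, hP1, hQ1, hR1, hp, h1, hr, hpP, h2, hrR, fun i => by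
      rw [sub_right_comm]; exact h3 i⟩
  by_cases hx1 : gP R = -1
  · -- P = Q + (-R), and gP P = 1 = gP (-R); base point -R, third Q
    obtain ⟨p', h1, h2, h3⟩ := nb_degen v hnorm (-R) P Q (by rw [hQ]; abel)
      (fun x => by
        obtain ⟨a, b, h⟩ := hspan x
        exact ⟨a - b, a, by rw [h, hQ]; module⟩)
      (fun i => - r i) p q (by simpa using hr) hp hq (by rw [hneg, hrR]) hpP hqQ gP gQ
      hgP hgQ (by rw [map_neg, hx1]; norm_num) hPP hQQ
    exact ⟨P, Q, R, p', q, r, hQ, hP1, hQ1, hR1, h1, hq, hr, h2, hqQ, hrR, fun i => by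
      rw [← abs_neg]
      convert h3 i using 2; ring⟩
  -- generic case
  have hx := abs_le.1 (bd gP R hgP hR1)
  have hxQ := abs_le.1 (bd gP Q hgP hQ1)
  have hy := abs_le.1 (bd gR P hgR hP1)
  have hyQ := abs_le.1 (bd gR Q hgR hQ1)
  have hzP := abs_le.1 (bd gQ P hgQ hP1)
  have hzR := abs_le.1 (bd gQ R hgQ hR1)
  rw [hQ, map_add, hPP] at hxQ
  rw [hQ, map_add, hRR] at hyQ
  have hQQ' := hQQ
  rw [hQ, map_add] at hQQ'
  have hpn := nb_norming v hnorm gP hgP p hp (by rw [hpP, hPP])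
  have hqn := nb_norming v hnorm gQ hgQ q hq (by rw [hqQ, hQQ])
  have hrn := nb_norming v hnorm gR hgR r hr (by rw [hrR, hRR])
  choose a b hab using fun i => hspan (v i)
  have sgn : ∀ s t : ℝ, s * t = |t| → s < 1 → t ≤ 0 := by
    intro s t h1 h2
    by_contra hc
    push Not at hc
    rw [abs_of_pos hc] at h1
    nlinarith
  have sgn' : ∀ s t : ℝ, s * t = |t| → -1 < s → 0 ≤ t := by
    intro s t h1 h2
    by_contra hc
    push Not at hc
    rw [abs_of_neg hc] at h1
    nlinarith
  have hxl : -1 < gP R := lt_of_le_of_ne hx.1 (Ne.symm hx1)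
  have hxu : gP R < 0 := lt_of_le_of_ne (by linarith) hx0
  have hyu : gR P < 0 := lt_of_le_of_ne (by linarith) hy0
  have eP : ∀ i, gP (v i) = a i + b i * gP R := fun i => by rw [hab i]; simp [hPP]
  have eR : ∀ i, gR (v i) = a i * gR P + b i := fun i => by rw [hab i]; simp [hRR]
  have eQ : ∀ i, gQ (v i) = a i * gQ P + b i * gQ R := fun i => by rw [hab i]; simp
  refine ⟨P, Q, R, p, fun i => if v i = 0 then p i else q i, r, hQ, hP1, hQ1, hR1, hp, fun i => ?_,
    hr, hpP, ?_, hrR, fun i => ?_⟩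
  · dsimp only
    split_ifs
    exacts [hp i, hq i]
  · rw [← hqQ]
    refine Finset.sum_congr rfl fun i _ => ?_
    dsimp only
    split_ifs with h
    · simp [h]
    · rfl
  · dsimp only
    split_ifs with h
    · simpa using hr i
    · have h1 := abs_le.1 (hp i)
      have h2 := abs_le.1 (hq i)
      have h3 := abs_le.1 (hr i)
      have hnz : ¬ (a i = 0 ∧ b i = 0) := fun hh => h (by rw [hab i, hh.1, hh.2]; simp)
      rw [abs_le]
      constructor
      · by_contra hc
        push Not at hc
        have s1 := sgn' _ _ (hpn i) (by linarith)
        have s2 := sgn _ _ (hqn i) (by linarith)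
        have s3 := sgn' _ _ (hrn i) (by linarith)
        rw [eP] at s1
        rw [eQ] at s2
        rw [eR] at s3
        have := nb_key (-a i) (-b i) (gP R) (gR P) (gQ P) (gQ R) hxl hxu hy.1 hyu (by linarith)
          (by linarith) hQQ' (by linarith) (by linarith) (by linarith)
        exact hnz ⟨by linarith, by linarith⟩
      · by_contra hc
        push Not at hc
        have s1 := sgn _ _ (hpn i) (by linarith)
        have s2 := sgn' _ _ (hqn i) (by linarith)
        have s3 := sgn _ _ (hrn i) (by linarith)
        rw [eP] at s1
        rw [eQ] at s2
        rw [eR] at s3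
        exact hnz (nb_key (a i) (b i) (gP R) (gR P) (gQ P) (gQ R) hxl hxu hy.1 hyu (by linarith)
          (by linarith) hQQ' (by linarith) (by linarith) (by linarith))

lemma nb_planar (hE : Module.finrank ℝ E = 2)
    (hnorm : ∀ p : Fin m → ℝ, (∀ i, |p i| ≤ 1) → ‖∑ i, p i • v i‖ ≤ 1)
    (hrep : ∀ P : E, ‖P‖ = 1 → ∃ p : Fin m → ℝ, (∀ i, |p i| ≤ 1) ∧ ∑ i, p i • v i = P) :
    ∃ (g : E →L[ℝ] ℝ) (w : Fin m → ℝ), (∀ i, |w i| ≤ 2) ∧ 3 * ∑ i, |w i| ≤ 2 * m ∧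
      ∑ i, w i * g (v i) = 1 ∧ ∑ i, |g (v i)| ≤ 1 := by
  obtain ⟨P, Q, R, p, q, r, hQ, hP1, hQ1, hR1, hp, hq, hr, hpP, hqQ, hrR, hs⟩ :=
    nb_reps v hE hnorm hrep
  have hfin : ∀ (X : E) (w : Fin m → ℝ), ‖X‖ = 1 → ∑ i, w i • v i = X → (∀ i, |w i| ≤ 2) →
      3 * ∑ i, |w i| ≤ 2 * m → ∃ (g : E →L[ℝ] ℝ) (w : Fin m → ℝ), (∀ i, |w i| ≤ 2) ∧
      3 * ∑ i, |w i| ≤ 2 * m ∧ ∑ i, w i * g (v i) = 1 ∧ ∑ i, |g (v i)| ≤ 1 := by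
    intro X w hX hw h2 h3
    obtain ⟨g, hg, hgX⟩ := exists_dual_vector'' ℝ X
    refine ⟨g, w, h2, h3, ?_, nb_sumabs v hnorm g hg⟩
    rw [hX, ← hw] at hgX
    simpa using hgX
  have tot : ∑ i, |q i - p i| + ∑ i, |q i - r i| + ∑ i, |p i + r i| ≤ 2 * m := by
    rw [← Finset.sum_add_distrib, ← Finset.sum_add_distrib]
    calc _ ≤ ∑ i : Fin m, (2 : ℝ) :=
          Finset.sum_le_sum fun i _ => nb_four _ _ _ (hp i) (hq i) (hr i) (hs i)
      _ = 2 * m := by simp [mul_comm]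
  by_cases c1 : 3 * ∑ i, |q i - p i| ≤ 2 * m
  · refine hfin R (fun i => q i - p i) hR1 ?_ (fun i => ?_) c1
    · simp only [sub_smul, Finset.sum_sub_distrib, hpP, hqQ, hQ]; abel
    · exact (abs_sub _ _).trans (by linarith [hp i, hq i])
  by_cases c2 : 3 * ∑ i, |q i - r i| ≤ 2 * m
  · refine hfin P (fun i => q i - r i) hP1 ?_ (fun i => ?_) c2
    · simp only [sub_smul, Finset.sum_sub_distrib, hrR, hqQ, hQ]; abel
    · exact (abs_sub _ _).trans (by linarith [hr i, hq i])
  · refine hfin Q (fun i => p i + r i) hQ1 ?_ (fun i => ?_) (by linarith)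
    · simp only [add_smul, Finset.sum_add_distrib, hrR, hpP, hQ]
    · exact (abs_add_le _ _).trans (by linarith [hr i, hp i])
end

lemma nb_quot {m : ℕ} (K : Submodule ℝ (Fin m → ℝ))
    (hE : Module.finrank ℝ ((Fin m → ℝ) ⧸ K) = 2) :
    ∃ (h w : Fin m → ℝ), (∀ c ∈ K, ∑ i, c i * h i = 0) ∧ (∀ i, |w i| ≤ 2) ∧
      3 * ∑ i, |w i| ≤ 2 * m ∧ ∑ i, w i * h i = 1 ∧ ∑ i, |h i| ≤ 1 := by
  have hcl : IsClosed (K : Set (Fin m → ℝ)) := K.closed_of_finiteDimensional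
  set v : Fin m → (Fin m → ℝ) ⧸ K := fun i => K.mkQ (Pi.single i 1) with hv
  have hsum : ∀ p : Fin m → ℝ, ∑ i, p i • v i = K.mkQ p := by
    intro p
    simp only [hv, ← map_smul, ← map_sum]
    congr 1
    funext j
    simp [Finset.sum_apply, Pi.single_apply]
  have hn : ∀ p : Fin m → ℝ, (∀ i, |p i| ≤ 1) ↔ ‖p‖ ≤ 1 := by
    intro p
    rw [pi_norm_le_iff_of_nonneg zero_le_one]
    rfl
  obtain ⟨g, w, h1, h2, h3, h4⟩ := nb_planar v hE
    (fun p hp => by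
      rw [hsum]
      exact (Submodule.Quotient.norm_mk_le K p).trans ((hn p).1 hp))
    (fun P hP => by
      obtain ⟨x, rfl⟩ := K.mkQ_surjective P
      obtain ⟨y, hy, hxy⟩ := hcl.exists_infDist_eq_dist ⟨0, K.zero_mem⟩ x
      have hx : ‖K.mkQ x‖ = Metric.infDist x K := QuotientAddGroup.norm_mk (S := K.toAddSubgroup) x
      refine ⟨x - y, (hn _).2 ?_, ?_⟩
      · rw [← dist_eq_norm, ← hxy, ← hx, hP]
      · rw [hsum, map_sub, sub_eq_self]
        simpa using hy)
  refine ⟨fun i => g (v i), w, fun c hc => ?_, h1, h2, h3, h4⟩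
  have : g (∑ i, c i • v i) = 0 := by
    rw [hsum, (Submodule.Quotient.mk_eq_zero K).2 hc |> fun h => (show K.mkQ c = 0 from h), map_zero]
  simpa using this

lemma nb_exists_K {d m : ℕ} (B : Matrix (Fin d) (Fin m) ℝ) (hm : d + 2 ≤ m) :
    ∃ K : Submodule ℝ (Fin m → ℝ), (∀ r, B r ∈ K) ∧ Module.finrank ℝ ((Fin m → ℝ) ⧸ K) = 2 := by
  have h1 := LinearMap.finrank_range_add_finrank_ker B.mulVecLin
  have h2 := Submodule.finrank_le (LinearMap.range B.mulVecLin)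
  simp only [Module.finrank_fin_fun] at h1 h2
  obtain ⟨f, hf⟩ := exists_linearIndependent_of_le_finrank
    (R := ℝ) (M := LinearMap.ker B.mulVecLin) (n := 2) (by omega)
  set H : Matrix (Fin 2) (Fin m) ℝ := fun j => (f j : Fin m → ℝ) with hH
  have hli : LinearIndependent ℝ H.row := 
    hf.map' (LinearMap.ker B.mulVecLin).subtype (Submodule.ker_subtype _)
  have hrk := hli.rank_matrix
  refine ⟨LinearMap.ker H.mulVecLin, fun r => ?_, ?_⟩
  · rw [LinearMap.mem_ker]
    funext j
    have h := (f j).2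
    rw [LinearMap.mem_ker] at h
    have := congrFun h r
    simp only [Matrix.mulVecLin_apply, Matrix.mulVec] at this ⊢
    rw [dotProduct_comm]
    exact this
  · rw [H.mulVecLin.quotKerEquivRange.finrank_eq]
    simpa [Matrix.rank] using hrk

/-- **McMullen–Shephard bound (via Donoho).** Let `A` be `d × n` with `d > 2` and
`n ≥ d + 2`. If for every `y` each solution `x0` of `A x0 = y` with at most `k` nonzeros is
the unique minimizer of `‖x‖₁` over `{x : A x = y}` (equivalently, `P = conv{±a_i}` is
`k`-neighbourly), then `k ≤ ⌊(d+1)/3⌋`. -/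
theorem neighbourliness_bound {d n : ℕ} (A : Matrix (Fin d) (Fin n) ℝ) (k : ℕ)
    (hd : 2 < d) (hn : d + 2 ≤ n)
    (hrec : ∀ (y : Fin d → ℝ) (x0 : Fin n → ℝ), A.mulVec x0 = y →
      (Finset.univ.filter fun i => x0 i ≠ 0).card ≤ k →
      ∀ x : Fin n → ℝ, A.mulVec x = y → x ≠ x0 → ∑ i, |x0 i| < ∑ i, |x i|) :
    k ≤ (d + 1) / 3 := by
  by_contra hk
  have hk3 : d + 2 ≤ 3 * k := by omega
  obtain ⟨K, hK, hE⟩ := nb_exists_K (A.submatrix id (Fin.castLE hn)) le_rfl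
  obtain ⟨h, w, h1, h2, h3, h4, h5⟩ := nb_quot K hE
  obtain ⟨S, hS, hle⟩ := nb_topk k (fun i => |h i|) (fun i => |w i| / 2) (fun i => abs_nonneg _)
    (fun i => by positivity) (fun i => by linarith [h2 i]) (by
      rw [← Finset.sum_div]
      have : ((d + 2 : ℕ) : ℝ) ≤ 3 * k := by exact_mod_cast hk3
      linarith)
  have hne : h ≠ 0 := by
    rintro rfl
    simp at h4
  have hlt := nb_nsp A k (Fin.castLE hn) (Fin.castLE_injective hn) hrec h (fun r => h1 _ (hK r)) hne S hS
  have : 1 ≤ ∑ i, |w i| * |h i| := by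
    rw [← h4]
    refine Finset.sum_le_sum fun i _ => ?_
    rw [← abs_mul]
    exact le_abs_self _
  have e : ∑ i, |w i| / 2 * |h i| = (∑ i, |w i| * |h i|) / 2 := by
    rw [Finset.sum_div]
    exact Finset.sum_congr rfl fun i _ => by ring
  linarith
end
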